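/- arXiv:1809.00192 — 8 statements merged into one kernel-verified Lean document; each statement's English description precedes it below -/
import Mathlib

section
/- For every τ in the upper half-plane H, one has ℘a(1/2 + τ, 2τ) = −(1/3)·(℘̃a(1/2, 2τ) + ℘̃a(τ, 2τ)). -/
open Complex

/-- The normalized Weierstrass function
`℘a(z,τ) = π⁻² (1/z² + Σ_{ω ∈ Λ_τ, ω ≠ 0} (1/(z-ω)² − 1/ω²))`, where `Λ_τ = ℤ + τℤ`. -/
noncomputable def wpa (z τ : ℂ) : ℂ :=
  (Real.pi : ℂ)⁻¹ ^ 2 * (1 / z ^ 2 +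
    ∑' p : ℤ × ℤ, if p = 0 then 0 else
      (1 / (z - ((p.1 : ℂ) + (p.2 : ℂ) * τ)) ^ 2 - 1 / ((p.1 : ℂ) + (p.2 : ℂ) * τ) ^ 2))

/-- The renormalized function
`℘̃a(z,τ) = π⁻² Σ_{(n,m)∈ℤ²} (1/(z+(n+1/2)+(m+1/2)τ)² − 1/((n+1/2)+(m+1/2)τ)²)`. -/
noncomputable def wpt (z τ : ℂ) : ℂ :=
  (Real.pi : ℂ)⁻¹ ^ 2 *
    ∑' p : ℤ × ℤ,
      (1 / (z + ((p.1 : ℂ) + 1 / 2) + ((p.2 : ℂ) + 1 / 2) * τ) ^ 2 -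
        1 / (((p.1 : ℂ) + 1 / 2) + ((p.2 : ℂ) + 1 / 2) * τ) ^ 2)

lemma hasSum_of_eq {ι : Type*} {f g : ι → ℂ} {a : ℂ} (h : ∀ i, f i = g i) (hg : HasSum g a) :
    HasSum f a := by
  rwa [show f = g from funext h]

/-- One-dimensional lattice sum `∑ 1/(w+n)²` (with `1/0 = 0`). -/
noncomputable def rowSum (w : ℂ) : ℂ := ∑' n : ℤ, ((w + n) ^ 2)⁻¹

lemma rowSum_summable (w : ℂ) : Summable fun n : ℤ ↦ ((w + n) ^ 2)⁻¹ := by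
  have := EisensteinSeries.linear_right_summable w 1 (k := 2) le_rfl
  refine this.congr fun n ↦ ?_
  simp only [Int.cast_one, one_mul]
  norm_cast

lemma hasSum_int_even_odd {f : ℤ → ℂ} {a b : ℂ} (he : HasSum (fun n : ℤ ↦ f (2 * n)) a)
    (ho : HasSum (fun n : ℤ ↦ f (2 * n + 1)) b) : HasSum f (a + b) := by
  have h2 : Function.Injective fun n : ℤ ↦ 2 * n := fun x y h ↦ by
    simp only at h; omega
  have h3 : Function.Injective fun n : ℤ ↦ 2 * n + 1 := fun x y h ↦ by
    simp only at h; omega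
  have he' := h2.hasSum_range_iff.mpr he
  have ho' := h3.hasSum_range_iff.mpr ho
  refine he'.add_isCompl ?_ ho'
  have e1 : Set.range (fun n : ℤ ↦ 2 * n) = {n : ℤ | Even n} := by
    ext x; simp only [Set.mem_range, Set.mem_ofPred_eq, even_iff_exists_two_mul, eq_comm]
  have e2 : Set.range (fun n : ℤ ↦ 2 * n + 1) = {n : ℤ | Odd n} := by
    ext x; simp only [Set.mem_range, Set.mem_ofPred_eq, Odd, eq_comm]
  rw [e1, e2]
  exact Int.isCompl_even_odd

lemma tsum_int_even_odd {f : ℤ → ℂ} (hf : Summable f) :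
    ∑' n, f n = ∑' n, f (2 * n) + ∑' n, f (2 * n + 1) := by
  refine (hasSum_int_even_odd (Summable.hasSum ?_) (Summable.hasSum ?_)).tsum_eq
  · exact hf.comp_injective (i := fun n : ℤ ↦ 2 * n) fun x y h ↦ by
      simp only at h; omega
  · exact hf.comp_injective (i := fun n : ℤ ↦ 2 * n + 1) fun x y h ↦ by
      simp only at h; omega

lemma rowSum_double (w : ℂ) : rowSum w + rowSum (w + 1 / 2) = 4 * rowSum (2 * w) := by
  unfold rowSum
  rw [tsum_int_even_odd (rowSum_summable (2 * w)), mul_add, ← tsum_mul_left, ← tsum_mul_left]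
  congr 1
  · refine tsum_congr fun n ↦ ?_
    rw [show (2 * w + ((2 * n : ℤ) : ℂ)) = 2 * (w + n) by push_cast; ring, mul_pow, mul_inv]
    ring
  · refine tsum_congr fun n ↦ ?_
    rw [show (2 * w + ((2 * n + 1 : ℤ) : ℂ)) = 2 * (w + 1 / 2 + n) by push_cast; ring,
      mul_pow, mul_inv]
    ring

lemma rowSum_neg (w : ℂ) : rowSum (-w) = rowSum w := by
  unfold rowSum
  rw [← (Equiv.neg ℤ).tsum_eq]
  refine tsum_congr fun n ↦ ?_
  simp only [Equiv.neg_apply, Int.cast_neg]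
  rw [← neg_add, neg_sq]

lemma rowSum_mul_summable (T : ℂ) (hT : 0 < T.im) : Summable fun m : ℤ ↦ rowSum (m * T) := by
  have key : Summable fun m : ℕ ↦ rowSum (((m + 1 : ℕ) : ℂ) * T) := by
    have hq : ‖Complex.exp (2 * Real.pi * I * T)‖ < 1 :=
      UpperHalfPlane.norm_exp_two_pi_I_lt_one ⟨T, hT⟩
    have h := (summable_prod_mul_pow 1 hq).prod
    rw [summable_pnat_iff_summable_succ
      (f := fun b : ℕ ↦ ∑' c : ℕ+, (c : ℂ) ^ 1 * Complex.exp (2 * Real.pi * I * T) ^ (b * c : ℕ))]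
      at h
    refine (h.mul_left ((-2 * Real.pi * I) ^ 2)).congr fun m ↦ ?_
    have hm : 0 < (((m + 1 : ℕ) : ℂ) * T).im := by
      have : (((m + 1 : ℕ) : ℂ) * T).im = ((m + 1 : ℕ) : ℝ) * T.im := by
        rw [← Complex.ofReal_natCast, Complex.im_ofReal_mul]
      rw [this]; positivity
    have H := EisensteinSeries.qExpansion_identity_pnat (k := 1) le_rfl ⟨((m + 1 : ℕ) : ℂ) * T, hm⟩
    simp only [one_div, Nat.factorial_one, Nat.cast_one, div_one, Nat.reduceAdd] at H
    unfold rowSum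
    refine Eq.trans ?_ H.symm
    congr 1
    refine tsum_congr fun n ↦ ?_
    congr 1
    rw [pow_mul, ← Complex.exp_nat_mul _ (m + 1)]
    congr 2
    ring
  have key2 : Summable fun m : ℕ ↦ rowSum ((m : ℂ) * T) :=
    (summable_nat_add_iff (f := fun m : ℕ ↦ rowSum ((m : ℂ) * T)) 1).mp key
  refine Summable.of_nat_of_neg_add_one ?_ ?_
  · simpa using key2
  · refine key.congr fun m ↦ ?_
    rw [← rowSum_neg]
    push_cast
    congr 1
    ring

/-- The period pair `(1, T)`. -/
noncomputable def pairOf (T : ℂ) (hT : 0 < T.im) : PeriodPair where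
  ω₁ := 1
  ω₂ := T
  indep := by
    rw [LinearIndependent.pair_iff]
    intro s t h
    have h2 := congrArg Complex.im h
    have h1 := congrArg Complex.re h
    simp at h1 h2
    have : t = 0 := by
      rcases h2 with h2 | h2
      · exact h2
      · exact absurd h2 hT.ne'
    subst this
    simpa using h1

lemma pairOf_hasSum (T : ℂ) (hT : 0 < T.im) (z : ℂ) :
    HasSum (fun p : ℤ × ℤ ↦ 1 / (z - ((p.1 : ℂ) + (p.2 : ℂ) * T)) ^ 2
      - 1 / ((p.1 : ℂ) + (p.2 : ℂ) * T) ^ 2) ((pairOf T hT).weierstrassP z) := by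
  have h := (pairOf T hT).hasSum_weierstrassP z
  rw [← (pairOf T hT).latticeEquivProd.symm.toEquiv.hasSum_iff] at h
  convert h using 1
  ext p
  have e := (pairOf T hT).latticeEquiv_symm_apply p
  have e' : (((pairOf T hT).latticeEquivProd.symm p : (pairOf T hT).lattice) : ℂ)
      = (p.1 : ℂ) + (p.2 : ℂ) * T := by
    rw [e]; simp only [pairOf, mul_one]
  simp only [Function.comp_apply, LinearEquiv.coe_toEquiv, e']

lemma pairOf_hasSum_add (T : ℂ) (hT : 0 < T.im) (z : ℂ) :
    HasSum (fun p : ℤ × ℤ ↦ 1 / (z + ((p.1 : ℂ) + (p.2 : ℂ) * T)) ^ 2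
      - 1 / ((p.1 : ℂ) + (p.2 : ℂ) * T) ^ 2) ((pairOf T hT).weierstrassP z) := by
  have h := pairOf_hasSum T hT z
  rw [← (Equiv.neg (ℤ × ℤ)).hasSum_iff] at h
  convert h using 1
  ext p
  simp only [Function.comp_apply, Equiv.neg_apply, Prod.fst_neg, Prod.snd_neg, Int.cast_neg]
  congr 2 <;> ring

lemma pairOf_rows (T : ℂ) (hT : 0 < T.im) (z : ℂ) :
    HasSum (fun m : ℤ ↦ rowSum (z + m * T) - rowSum (m * T)) ((pairOf T hT).weierstrassP z) := by
  have h := pairOf_hasSum_add T hT z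
  rw [← (Equiv.prodComm ℤ ℤ).hasSum_iff] at h
  refine h.prod_fiberwise fun m ↦ ?_
  refine hasSum_of_eq (fun n ↦ ?_)
    ((rowSum_summable (z + m * T)).hasSum.sub (rowSum_summable (m * T)).hasSum)
  simp only [Function.comp_apply, Equiv.prodComm_apply, Prod.swap, one_div]
  rw [show z + ((n : ℂ) + m * T) = z + m * T + n by ring,
    show (n : ℂ) + m * T = m * T + n by ring]

lemma pairOf_sum_zero (τ : ℂ) (hT : 0 < (2 * τ).im) :
    (pairOf (2 * τ) hT).weierstrassP (1 / 2) + (pairOf (2 * τ) hT).weierstrassP τ +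
      (pairOf (2 * τ) hT).weierstrassP (1 / 2 + τ) = 0 := by
  have h := ((pairOf_rows _ hT (1 / 2)).add (pairOf_rows _ hT τ)).add
    (pairOf_rows _ hT (1 / 2 + τ))
  have hs := rowSum_mul_summable (2 * τ) hT
  have he : Summable fun m : ℤ ↦ rowSum (((2 * m : ℤ) : ℂ) * (2 * τ)) :=
    hs.comp_injective (i := fun n : ℤ ↦ 2 * n) fun x y h ↦ by simp only at h; omega
  have ho : Summable fun m : ℤ ↦ rowSum (((2 * m + 1 : ℤ) : ℂ) * (2 * τ)) :=
    hs.comp_injective (i := fun n : ℤ ↦ 2 * n + 1) fun x y h ↦ by simp only at h; omega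
  have h2 := ((he.hasSum.add ho.hasSum).sub hs.hasSum).mul_left 4
  rw [← tsum_int_even_odd hs, sub_self, mul_zero] at h2
  refine h.unique ?_
  refine hasSum_of_eq (fun m ↦ ?_) h2
  have a := rowSum_double (m * (2 * τ))
  have b := rowSum_double (τ + m * (2 * τ))
  rw [show (m : ℂ) * (2 * τ) + 1 / 2 = 1 / 2 + m * (2 * τ) by ring,
    show 2 * ((m : ℂ) * (2 * τ)) = ((2 * m : ℤ) : ℂ) * (2 * τ) by push_cast; ring] at a
  rw [show τ + (m : ℂ) * (2 * τ) + 1 / 2 = 1 / 2 + τ + m * (2 * τ) by ring,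
    show 2 * (τ + (m : ℂ) * (2 * τ)) = ((2 * m + 1 : ℤ) : ℂ) * (2 * τ) by push_cast; ring] at b
  linear_combination a + b

lemma wpa_eq (T : ℂ) (hT : 0 < T.im) (z : ℂ) :
    wpa z T = (Real.pi : ℂ)⁻¹ ^ 2 * (pairOf T hT).weierstrassP z := by
  unfold wpa
  congr 1
  have h := pairOf_hasSum T hT z
  rw [← h.tsum_eq, h.summable.tsum_eq_add_tsum_ite 0]
  simp

lemma wpt_eq (T : ℂ) (hT : 0 < T.im) (z : ℂ) :
    wpt z T = (Real.pi : ℂ)⁻¹ ^ 2 * ((pairOf T hT).weierstrassP (z + (1 / 2 + T / 2)) -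
      (pairOf T hT).weierstrassP (1 / 2 + T / 2)) := by
  unfold wpt
  congr 1
  refine HasSum.tsum_eq ?_
  refine hasSum_of_eq (fun p ↦ ?_) ((pairOf_hasSum_add T hT (z + (1 / 2 + T / 2))).sub
    (pairOf_hasSum_add T hT (1 / 2 + T / 2)))
  rw [sub_sub_sub_cancel_right]
  congr 3 <;> ring

/-- `℘a(1/2 + τ, 2τ) = −(1/3)(℘̃a(1/2, 2τ) + ℘̃a(τ, 2τ))` for `τ` in the upper half-plane. -/
theorem wpa_half_add_eq (τ : ℂ) (hτ : 0 < τ.im) :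
    wpa (1 / 2 + τ) (2 * τ) = -(1 / 3) * (wpt (1 / 2) (2 * τ) + wpt τ (2 * τ)) := by
  have hT : 0 < (2 * τ).im := by simpa using hτ
  have h1 : (pairOf (2 * τ) hT).weierstrassP (1 / 2 + (1 / 2 + 2 * τ / 2)) =
      (pairOf (2 * τ) hT).weierstrassP τ := by
    rw [← (pairOf (2 * τ) hT).weierstrassP_add_coe τ ⟨_, (pairOf (2 * τ) hT).ω₁_mem_lattice⟩]
    congr 1
    simp only [pairOf]
    ring
  have h2 : (pairOf (2 * τ) hT).weierstrassP (τ + (1 / 2 + 2 * τ / 2)) =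
      (pairOf (2 * τ) hT).weierstrassP (1 / 2) := by
    rw [← (pairOf (2 * τ) hT).weierstrassP_add_coe (1 / 2)
      ⟨_, (pairOf (2 * τ) hT).ω₂_mem_lattice⟩]
    congr 1
    simp only [pairOf]
    ring
  rw [wpa_eq _ hT, wpt_eq _ hT, wpt_eq _ hT, h1, h2,
    show (1 / 2 + 2 * τ / 2 : ℂ) = 1 / 2 + τ by ring]
  linear_combination (Real.pi : ℂ)⁻¹ ^ 2 / 3 * pairOf_sum_zero τ hT
end

section
/- For every τ in the upper half-plane H and every z ∈ ℂ∖(ℤ + τℤ), one has ℘a(z,τ) = ℘̃a(z + (1+τ)/2, τ) − (1/3)·(℘̃a(1/2, τ) + ℘̃a(τ/2, τ)). -/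
open Complex

namespace WPA
open PeriodPair Filter Topology

lemma order_top_of_ode (d q : ℂ → ℂ) (hd : AnalyticAt ℂ d 0) (hq : AnalyticAt ℂ q 0)
    (h0 : d 0 = 0) (h1 : deriv d 0 = 0) (h2 : deriv (deriv d) =ᶠ[𝓝 0] q * d) :
    analyticOrderAt d 0 = ⊤ := by
  have e1 := hd.analyticOrderAt_deriv_add_one
  have e2 := hd.deriv.analyticOrderAt_deriv_add_one
  simp only [h0, h1, sub_zero] at e1 e2
  rw [analyticOrderAt_congr h2, analyticOrderAt_mul hq hd] at e2
  rw [← e2] at e1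
  by_contra hn
  have hq' : analyticOrderAt q 0 ≠ ⊤ := by
    intro h
    rw [h] at e1
    simp at e1
    exact hn e1.symm
  change _ = analyticOrderAt d 0 at e1
  generalize analyticOrderAt d 0 = n at *
  generalize analyticOrderAt q 0 = m at *
  lift n to ℕ using hn
  lift m to ℕ using hq'
  norm_cast at e1
  omega

variable (L : PeriodPair)

lemma eventually_notMem {a : ℂ} (ha : a ∉ L.lattice) : ∀ᶠ z in 𝓝 a, z ∉ L.lattice :=
  L.isClosed_lattice.isOpen_compl.mem_nhds ha

lemma hasDerivAt_P {a : ℂ} (ha : a ∉ L.lattice) :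
    HasDerivAt L.weierstrassP (L.derivWeierstrassP a) a := by
  rw [← L.deriv_weierstrassP]
  exact (L.analyticOnNhd_weierstrassP a ha).differentiableAt.hasDerivAt

lemma deriv_deriv_P {a : ℂ} (ha : a ∉ L.lattice) :
    deriv L.derivWeierstrassP a = 6 * L.weierstrassP a ^ 2 - L.g₂ / 2 := by
  have h0 : meromorphicOrderAt L.derivWeierstrassP 0 ≠ ⊤ := by
    have := meromorphicOrderAt_deriv_eq_sub_one (n := -2) (by norm_num)
      (L.order_weierstrassP 0 (zero_mem _))
    rw [L.deriv_weierstrassP] at this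
    rw [this]; exact WithTop.coe_ne_top
  have ha' : meromorphicOrderAt L.derivWeierstrassP a ≠ ⊤ :=
    MeromorphicOn.meromorphicOrderAt_ne_top_of_isPreconnected (U := Set.univ)
      (fun z _ => L.meromorphic_derivWeierstrassP z) isPreconnected_univ trivial trivial h0
  rw [meromorphicOrderAt_ne_top_iff_eventually_ne_zero (L.meromorphic_derivWeierstrassP a)] at ha'
  have hP := L.analyticOnNhd_weierstrassP a ha
  have hP' := L.analyticOnNhd_derivWeierstrassP a ha
  have c1 : ContinuousAt (deriv L.derivWeierstrassP) a := hP'.deriv.continuousAt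
  have c2 : ContinuousAt (fun z => 6 * L.weierstrassP z ^ 2 - L.g₂ / 2) a := by
    have := hP.continuousAt
    fun_prop
  refine ((c1.eventuallyEq_nhds_iff_eventuallyEq_nhdsNE c2).1 ?_).eq_of_nhds
  filter_upwards [ha', (eventually_notMem L ha).filter_mono nhdsWithin_le_nhds] with z hz hzL
  have hrel : (fun z => L.derivWeierstrassP z ^ 2) =ᶠ[𝓝 z]
      fun z => 4 * L.weierstrassP z ^ 3 - L.g₂ * L.weierstrassP z - L.g₃ := by
    filter_upwards [eventually_notMem L hzL] with w hw using L.derivWeierstrassP_sq w hw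
  have d1 := ((L.analyticOnNhd_derivWeierstrassP z hzL).differentiableAt.hasDerivAt.pow 2)
  have d2 := ((((hasDerivAt_P L hzL).pow 3).const_mul 4).sub
    ((hasDerivAt_P L hzL).const_mul L.g₂)).sub_const L.g₃
  have := (d1.congr_of_eventuallyEq hrel.symm).unique d2
  apply mul_left_cancel₀ hz
  norm_num at this
  linear_combination this / 2

lemma P'_half {a : ℂ} (ha : 2 * a ∈ L.lattice) : L.derivWeierstrassP a = 0 := by
  have h := L.derivWeierstrassP_sub_coe a ⟨_, ha⟩
  simp only at h
  rw [show a - 2 * a = -a by ring, L.derivWeierstrassP_neg] at h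
  linear_combination -h / 2

lemma P_half_ne {a b : ℂ} (ha : a ∉ L.lattice) (hb : b ∉ L.lattice) (hab : b - a ∉ L.lattice)
    (ha2 : 2 * a ∈ L.lattice) (hb2 : 2 * b ∈ L.lattice) :
    L.weierstrassP a ≠ L.weierstrassP b := by
  intro heq
  set d : ℂ → ℂ := fun z => L.weierstrassP (z + a) - L.weierstrassP (z + b) with hd
  have ca : Tendsto (fun z : ℂ => z + a) (𝓝 0) (𝓝 a) := by
    have : ContinuousAt (fun z : ℂ => z + a) 0 := by fun_prop
    simpa [ContinuousAt] using this
  have cb : Tendsto (fun z : ℂ => z + b) (𝓝 0) (𝓝 b) := by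
    have : ContinuousAt (fun z : ℂ => z + b) 0 := by fun_prop
    simpa [ContinuousAt] using this
  have an : ∀ c : ℂ, c ∉ L.lattice → AnalyticAt ℂ (fun z => L.weierstrassP (z + c)) 0 := by
    intro c hc
    exact AnalyticAt.fun_comp (g := L.weierstrassP) (f := fun z => z + c)
      (by simpa using L.analyticOnNhd_weierstrassP c hc) (by fun_prop)
  have hev := (ca.eventually (eventually_notMem L ha)).and
    (cb.eventually (eventually_notMem L hb))
  have hd1 : deriv d =ᶠ[𝓝 0]
      fun z => L.derivWeierstrassP (z + a) - L.derivWeierstrassP (z + b) := by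
    filter_upwards [hev] with z hz
    exact (((hasDerivAt_P L hz.1).comp_add_const z a).sub
      ((hasDerivAt_P L hz.2).comp_add_const z b)).deriv
  have hord : analyticOrderAt d 0 = ⊤ := by
    refine order_top_of_ode d
      (fun z => 6 * (L.weierstrassP (z + a) + L.weierstrassP (z + b)))
      ((an a ha).sub (an b hb)) (analyticAt_const.mul ((an a ha).add (an b hb)))
      (by simp [hd, heq]) ?_ ?_
    · rw [hd1.eq_of_nhds]; simp [P'_half L ha2, P'_half L hb2]
    · refine hd1.deriv.trans ?_
      filter_upwards [hev] with z hz
      have := (((L.analyticOnNhd_derivWeierstrassP _ hz.1).differentiableAt.hasDerivAt.comp_add_const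
        z a).sub ((L.analyticOnNhd_derivWeierstrassP _ hz.2).differentiableAt.hasDerivAt.comp_add_const
        z b)).deriv
      refine this.trans ?_
      rw [deriv_deriv_P L hz.1, deriv_deriv_P L hz.2]
      simp only [Pi.mul_apply, hd]
      ring
  have hmero : Meromorphic d := by
    intro z
    refine MeromorphicAt.sub ?_ ?_
    · exact meromorphicAt_comp_add_const_iff_meromorphicAt.2 (L.meromorphic_weierstrassP _)
    · exact meromorphicAt_comp_add_const_iff_meromorphicAt.2 (L.meromorphic_weierstrassP _)
  have hne : meromorphicOrderAt d (-a) ≠ ⊤ := by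
    have o1 : meromorphicOrderAt (fun z => L.weierstrassP (z + a)) (-a) = -2 := by
      rw [meromorphicOrderAt_fun_comp_add_const_eq_meromorphicOrderAt]
      exact L.order_weierstrassP _ (by simp)
    have h2 : AnalyticAt ℂ (fun z => -L.weierstrassP (z + b)) (-a) := by
      refine AnalyticAt.neg (AnalyticAt.fun_comp (g := L.weierstrassP) (f := fun z => z + b) ?_
        (by fun_prop))
      rw [neg_add_eq_sub]
      exact L.analyticOnNhd_weierstrassP _ hab
    have h3 : d = (fun z => L.weierstrassP (z + a)) + (fun z => -L.weierstrassP (z + b)) := by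
      ext z; simp [hd, sub_eq_add_neg]
    rw [h3, meromorphicOrderAt_add_eq_left_of_lt h2.meromorphicAt, o1]
    · exact WithTop.coe_ne_top
    · rw [o1]
      refine lt_of_lt_of_le ?_ h2.meromorphicOrderAt_nonneg
      decide
  have := MeromorphicOn.meromorphicOrderAt_ne_top_of_isPreconnected (U := Set.univ) (y := 0)
      (fun z _ => hmero z) isPreconnected_univ trivial trivial hne
  apply this
  have hda : AnalyticAt ℂ d 0 := (an a ha).sub (an b hb)
  rw [hda.meromorphicOrderAt_eq, hord]; rfl

lemma sum_half : L.weierstrassP (L.ω₁ / 2) + L.weierstrassP (L.ω₂ / 2) +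
    L.weierstrassP ((L.ω₁ + L.ω₂) / 2) = 0 := by
  have n1 := L.ω₁_div_two_notMem_lattice
  have n2 := L.ω₂_div_two_notMem_lattice
  have m1 := L.ω₁_mem_lattice
  have m2 := L.ω₂_mem_lattice
  have n3 : (L.ω₁ + L.ω₂) / 2 ∉ L.lattice := by
    have := (L.mul_ω₁_add_mul_ω₂_mem_lattice (α := 1 / 2) (β := 1 / 2)).not.mpr (by norm_num)
    convert this using 2
    push_cast; ring
  have h1 : 2 * (L.ω₁ / 2) ∈ L.lattice := by rwa [mul_div_cancel₀ _ two_ne_zero]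
  have h2 : 2 * (L.ω₂ / 2) ∈ L.lattice := by rwa [mul_div_cancel₀ _ two_ne_zero]
  have h3 : 2 * ((L.ω₁ + L.ω₂) / 2) ∈ L.lattice := by
    rw [mul_div_cancel₀ _ two_ne_zero]; exact add_mem m1 m2
  have d12 : L.weierstrassP (L.ω₁ / 2) ≠ L.weierstrassP (L.ω₂ / 2) := by
    refine P_half_ne L n1 n2 (fun h => n3 ?_) h1 h2
    have := add_mem h m1
    rwa [show L.ω₂ / 2 - L.ω₁ / 2 + L.ω₁ = (L.ω₁ + L.ω₂) / 2 by ring] at this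
  have d13 : L.weierstrassP (L.ω₁ / 2) ≠ L.weierstrassP ((L.ω₁ + L.ω₂) / 2) := by
    refine P_half_ne L n1 n3 (fun h => n2 ?_) h1 h3
    rwa [show (L.ω₁ + L.ω₂) / 2 - L.ω₁ / 2 = L.ω₂ / 2 by ring] at h
  have d23 : L.weierstrassP (L.ω₂ / 2) ≠ L.weierstrassP ((L.ω₁ + L.ω₂) / 2) := by
    refine P_half_ne L n2 n3 (fun h => n1 ?_) h2 h3
    rwa [show (L.ω₁ + L.ω₂) / 2 - L.ω₂ / 2 = L.ω₁ / 2 by ring] at h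
  have r1 := L.derivWeierstrassP_sq _ n1
  have r2 := L.derivWeierstrassP_sq _ n2
  have r3 := L.derivWeierstrassP_sq _ n3
  rw [P'_half L h1] at r1
  rw [P'_half L h2] at r2
  rw [P'_half L h3] at r3
  generalize L.weierstrassP (L.ω₁ / 2) = x at *
  generalize L.weierstrassP (L.ω₂ / 2) = y at *
  generalize L.weierstrassP ((L.ω₁ + L.ω₂) / 2) = w at *
  have s1 : 4 * (x ^ 2 + x * y + y ^ 2) - L.g₂ = 0 :=
    mul_left_cancel₀ (sub_ne_zero.2 d12) (by linear_combination r2 - r1)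
  have s2 : 4 * (x ^ 2 + x * w + w ^ 2) - L.g₂ = 0 :=
    mul_left_cancel₀ (sub_ne_zero.2 d13) (by linear_combination r3 - r1)
  exact mul_left_cancel₀ (sub_ne_zero.2 d23) (by linear_combination (s1 - s2) / 4)

/-- The period pair `(1, τ)`. -/
noncomputable def pp (τ : ℂ) (hτ : 0 < τ.im) : PeriodPair where
  ω₁ := 1
  ω₂ := τ
  indep := by
    rw [LinearIndependent.pair_iff]
    intro s t h
    have him := congrArg Complex.im h
    have hre := congrArg Complex.re h
    simp at him hre
    have ht : t = 0 := him.resolve_right hτ.ne'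
    simp [ht] at hre
    exact ⟨hre, ht⟩

lemma wpa_eq (τ : ℂ) (hτ : 0 < τ.im) (z : ℂ) :
    wpa z τ = (Real.pi : ℂ)⁻¹ ^ 2 * (pp τ hτ).weierstrassP z := by
  set L := pp τ hτ with hL
  have h := L.weierstrassPExcept_add 0 z
  have e : ∀ p : ℤ × ℤ, (L.latticeEquivProd.symm p : ℂ) = p.1 + p.2 * τ := by
    intro p
    rw [L.latticeEquiv_symm_apply]
    simp [hL, pp]
  rw [wpa, ← h, PeriodPair.weierstrassPExcept, ← L.latticeEquivProd.symm.toEquiv.tsum_eq]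
  simp only [ZeroMemClass.coe_zero, sub_zero]
  have : ∀ p : ℤ × ℤ, ((L.latticeEquivProd.symm.toEquiv p : L.lattice) : ℂ) = 0 ↔ p = 0 := by
    intro p
    simp
  simp only [this]
  simp only [LinearEquiv.coe_toEquiv, e]
  norm_num
  ring

lemma wpt_eq (τ : ℂ) (hτ : 0 < τ.im) (z : ℂ) :
    wpt z τ = (Real.pi : ℂ)⁻¹ ^ 2 * ((pp τ hτ).weierstrassP (z + (1 + τ) / 2) -
      (pp τ hτ).weierstrassP ((1 + τ) / 2)) := by
  set L := pp τ hτ with hL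
  have e : ∀ p : ℤ × ℤ, (L.latticeEquivProd.symm p : ℂ) = p.1 + p.2 * τ := by
    intro p
    rw [L.latticeEquiv_symm_apply]
    simp [hL, pp]
  have hs := (L.hasSum_weierstrassP (z + (1 + τ) / 2)).sub (L.hasSum_weierstrassP ((1 + τ) / 2))
  rw [wpt, ← hs.tsum_eq, ← ((Equiv.neg _).trans L.latticeEquivProd.symm.toEquiv).tsum_eq]
  congr 1
  refine tsum_congr fun p => ?_
  simp only [Equiv.trans_apply, Equiv.neg_apply, LinearEquiv.coe_toEquiv, e]
  simp only [Prod.fst_neg, Prod.snd_neg, Int.cast_neg]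
  rw [sub_sub_sub_cancel_right]
  congr 3 <;> ring

end WPA

/-- `℘a(z,τ) = ℘̃a(z + (1+τ)/2, τ) − (1/3)(℘̃a(1/2, τ) + ℘̃a(τ/2, τ))`
for `z` outside the lattice `ℤ + τℤ`. -/
theorem wpa_eq_wpt_shift (τ : ℂ) (hτ : 0 < τ.im) (z : ℂ)
    (hz : ∀ n m : ℤ, z ≠ (n : ℂ) + (m : ℂ) * τ) :
    wpa z τ = wpt (z + (1 + τ) / 2) τ - (1 / 3) * (wpt (1 / 2) τ + wpt (τ / 2) τ) := by
  rw [WPA.wpa_eq τ hτ, WPA.wpt_eq τ hτ, WPA.wpt_eq τ hτ, WPA.wpt_eq τ hτ]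
  have hsum := WPA.sum_half (WPA.pp τ hτ)
  set L := WPA.pp τ hτ with hL
  have w1 : L.ω₁ = 1 := rfl
  have w2 : L.ω₂ = τ := rfl
  have m1 : (1 : ℂ) ∈ L.lattice := L.ω₁_mem_lattice
  have m2 : τ ∈ L.lattice := L.ω₂_mem_lattice
  rw [w1, w2] at hsum
  have a1 := L.weierstrassP_add_coe z ⟨1 + τ, add_mem m1 m2⟩
  have a2 := L.weierstrassP_add_coe (τ / 2) ⟨1, m1⟩
  have a3 := L.weierstrassP_add_coe (1 / 2) ⟨τ, m2⟩
  simp only at a1 a2 a3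
  rw [show z + (1 + τ) / 2 + (1 + τ) / 2 = z + (1 + τ) by ring, a1,
    show 1 / 2 + (1 + τ) / 2 = τ / 2 + 1 by ring, a2,
    show τ / 2 + (1 + τ) / 2 = 1 / 2 + τ by ring, a3]
  linear_combination (Real.pi : ℂ)⁻¹ ^ 2 / 3 * hsum
end

section
/- Let N ≥ 2 be an integer. The function Φ_N(τ) = (−3/(N−1)) Σ_{k=1}^{N−1} ℘a(kτ, Nτ) is a modular form of weight 2 for Γ₀(N); moreover Φ_N(τ) → 1 as Im τ → +∞ (i.e. its q-expansion has constant term 1, so Φ_N is unitary of valuation 0). -/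
open Complex

section PhiAux
open UpperHalfPlane hiding I
open EisensteinSeries ModularForm CongruenceSubgroup MatrixGroups Filter Topology Matrix.SpecialLinearGroup
  SummationFilter

/-- `diag(N,1)` -/
noncomputable def phiDiag (N : ℕ) (hN : 2 ≤ N) : GL (Fin 2) ℝ :=
  Matrix.GeneralLinearGroup.mkOfDetNeZero !![(N : ℝ), 0; 0, 1] (by simp; omega)

lemma phiDiag_det (N : ℕ) (hN : 2 ≤ N) : (phiDiag N hN).det.val = N := by
  simp [phiDiag, Matrix.GeneralLinearGroup.mkOfDetNeZero]

lemma phiDiag_det_pos (N : ℕ) (hN : 2 ≤ N) : 0 < (phiDiag N hN).det.val := by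
  rw [phiDiag_det]; exact_mod_cast (by omega : 0 < N)

lemma phiDiag_smul (N : ℕ) (hN : 2 ≤ N) (τ : ℍ) :
    ((phiDiag N hN • τ : ℍ) : ℂ) = N * τ := by
  rw [UpperHalfPlane.coe_smul_of_det_pos (phiDiag_det_pos N hN)]
  simp [phiDiag, num, denom, Matrix.GeneralLinearGroup.mkOfDetNeZero]

lemma phiDiag_slash (N : ℕ) (hN : 2 ≤ N) (f : ℍ → ℂ) (τ : ℍ) :
    (f ∣[(2 : ℤ)] phiDiag N hN) τ = N * f (phiDiag N hN • τ) := by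
  have h := phiDiag_det_pos N hN
  have hd : denom (phiDiag N hN) τ = 1 := by
    simp [phiDiag, denom, Matrix.GeneralLinearGroup.mkOfDetNeZero]
  rw [ModularForm.slash_apply, hd, σ, if_pos h, phiDiag_det]
  simp [mul_comm]

lemma D2_bdd (γ : SL(2, ℤ)) : IsBoundedAtImInfty (D2 γ) := by
  rw [isBoundedAtImInfty_iff]
  refine ⟨2 * Real.pi, 1, fun z hz => ?_⟩
  have hd := denom_ne_zero γ z
  simp only [D2, norm_div, norm_mul, norm_I, Complex.norm_real, Complex.norm_intCast]
  rw [div_le_iff₀ (norm_pos_iff.mpr hd)]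
  have h1 : |((γ 1 0 : ℤ) : ℝ)| ≤ ‖denom γ z‖ := by
    have h2 := Complex.abs_im_le_norm (denom γ z)
    have h3 : (denom γ z).im = (γ 1 0 : ℤ) * z.im := by
      simp [ModularGroup.denom_apply]
    rw [h3, abs_mul, abs_of_pos z.im_pos] at h2
    nlinarith [abs_nonneg ((γ 1 0 : ℤ) : ℝ)]
  have : (0 : ℝ) ≤ Real.pi := Real.pi_pos.le
  simp only [Complex.norm_ofNat, mul_one, Real.norm_eq_abs, abs_of_nonneg this]
  gcongr

lemma E2_bdd_cusp {c : OnePoint ℝ} (hc : IsCusp c 𝒮ℒ) : c.IsBoundedAt E2 2 := by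
  rw [OnePoint.isBoundedAt_iff_forall_SL2Z hc]
  intro γ _
  rw [E2_slash_action]
  have := (D2_bdd γ).const_mul_left (1 / (2 * riemannZeta 2))
  exact isBoundedAtImInfty_E2.sub this

lemma phiDiag_cusp (N : ℕ) (hN : 2 ≤ N) {c : OnePoint ℝ} (hc : IsCusp c 𝒮ℒ) :
    IsCusp (phiDiag N hN • c) 𝒮ℒ := by
  rw [isCusp_SL2Z_iff] at hc ⊢
  obtain ⟨x, rfl⟩ := hc
  let A : GL (Fin 2) ℚ := Matrix.GeneralLinearGroup.mkOfDetNeZero !![(N : ℚ), 0; 0, 1]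
    (by simp; omega)
  refine ⟨A • x, ?_⟩
  rw [← Rat.coe_castHom, OnePoint.map_smul]
  congr 1
  ext i j
  fin_cases i <;> fin_cases j <;>
    simp [A, phiDiag, Matrix.GeneralLinearGroup.mkOfDetNeZero]

lemma E2_tendsto : Tendsto E2 atImInfty (𝓝 1) := by
  let g : ℍ → ℂ := fun τ => (E2 τ - 1) / Function.Periodic.qParam 1 τ
  have hq (τ : ℍ) : Function.Periodic.qParam 1 τ = cexp (2 * Real.pi * I * τ) := by
    simp [Function.Periodic.qParam]
  have hg : IsBoundedAtImInfty g := by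
    refine isBoundedAtImInfty_of_hasSum_qExpansion
      (c := fun m => -24 * ArithmeticFunction.sigma 1 (m+1)) one_pos fun τ ↦ ?_
    have h := hasSum_qExpansion_E2 (z := τ)
    rw [← hasSum_nat_add_iff' 1] at h
    have h' := h.div_const (Function.Periodic.qParam 1 τ)
    simp only [Finset.sum_range_one, if_true, pow_zero, smul_eq_mul, mul_one] at h'
    convert! h' using 2 with m
    rw [hq]
    have := Complex.exp_ne_zero (2 * Real.pi * I * τ)
    simp only [Nat.succ_ne_zero, if_false, smul_eq_mul]
    rw [pow_succ, eq_div_iff this, mul_assoc]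
  have h0 : Tendsto (fun τ : ℍ => Function.Periodic.qParam 1 τ * g τ) atImInfty (𝓝 0) := by
    have := (qParam_tendsto_atImInfty one_pos).zero_mul_isBoundedUnder_le (g := g) ?_
    · exact this
    · exact hg.isBoundedUnder_le
  have h1 := h0.const_add 1
  rw [add_zero] at h1
  refine h1.congr fun τ => ?_
  have : Function.Periodic.qParam 1 (τ : ℂ) ≠ 0 := by rw [hq]; exact Complex.exp_ne_zero _
  simp only [g]
  field_simp
  ring

lemma phiDiag_mul_gamma (N : ℕ) (hN : 2 ≤ N) (γ : SL(2, ℤ)) (hγ : γ ∈ Gamma0 N) :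
    (E2 ∣[(2 : ℤ)] phiDiag N hN) ∣[(2 : ℤ)] γ =
      (E2 ∣[(2 : ℤ)] phiDiag N hN) - (1 / (2 * riemannZeta 2)) • D2 γ := by
  obtain ⟨c, hc⟩ : (N : ℤ) ∣ γ 1 0 := by
    rw [Gamma0_mem] at hγ
    exact (ZMod.intCast_zmod_eq_zero_iff_dvd _ _).mp hγ
  have hdet := γ.det_coe
  rw [Matrix.det_fin_two] at hdet
  let γ' : SL(2, ℤ) := ⟨!![γ 0 0, N * γ 0 1; c, γ 1 1], by
    rw [Matrix.det_fin_two_of]; rw [hc] at hdet; linarith⟩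
  have h00 : γ' 0 0 = γ 0 0 := rfl
  have h01 : γ' 0 1 = N * γ 0 1 := rfl
  have h10 : γ' 1 0 = c := rfl
  have h11 : γ' 1 1 = γ 1 1 := rfl
  have key : phiDiag N hN * mapGL ℝ γ = mapGL ℝ γ' * phiDiag N hN := by
    ext i j
    fin_cases i <;> fin_cases j <;>
      simp [h00, h01, h10, h11, phiDiag, Matrix.GeneralLinearGroup.mkOfDetNeZero, Matrix.mul_apply, hc, mul_comm]
  have e1 : (E2 ∣[(2 : ℤ)] phiDiag N hN) ∣[(2 : ℤ)] γ =
      (E2 ∣[(2 : ℤ)] γ') ∣[(2 : ℤ)] phiDiag N hN := by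
    have := congrArg (fun g => E2 ∣[(2 : ℤ)] g) key
    simp only [SlashAction.slash_mul] at this
    exact this
  rw [e1, E2_slash_action]
  ext τ
  simp only [phiDiag_slash, Pi.sub_apply, Pi.smul_apply, smul_eq_mul, mul_sub]
  congr 1
  have hd : denom γ' (phiDiag N hN • τ : ℍ) = denom γ τ := by
    rw [ModularGroup.denom_apply, ModularGroup.denom_apply, phiDiag_smul]
    simp [γ', hc]; ring
  simp only [D2, hd]
  simp [γ', hc]; ring

/-- The form `(E2|diag(N,1) - E2)/(N-1)`. -/
noncomputable def phiFun (N : ℕ) (hN : 2 ≤ N) : ℍ → ℂ :=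
  (1 / ((N : ℂ) - 1)) • ((E2 ∣[(2 : ℤ)] phiDiag N hN) - E2)

noncomputable def phiMF (N : ℕ) (hN : 2 ≤ N) : ModularForm (Gamma0 N) 2 where
  toFun := phiFun N hN
  slash_action_eq' := by
    rintro g ⟨γ, hγ, rfl⟩
    have h : phiFun N hN ∣[(2 : ℤ)] γ = phiFun N hN := by
      rw [phiFun, SL_smul_slash, sub_eq_add_neg _ E2, SlashAction.add_slash, SlashAction.neg_slash,
        phiDiag_mul_gamma N hN γ hγ, E2_slash_action]
      congr 1
      abel
    exact h
  holo' := ((E2_mdifferentiable.slash 2 _).sub E2_mdifferentiable).const_smul _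
  bdd_at_cusps' {c} hc := by
    have : NeZero N := ⟨by omega⟩
    rw [Subgroup.IsArithmetic.isCusp_iff_isCusp_SL2Z] at hc
    have h1 : c.IsBoundedAt (E2 ∣[(2 : ℤ)] phiDiag N hN) 2 :=
      OnePoint.IsBoundedAt.smul_iff.mp (E2_bdd_cusp (phiDiag_cusp N hN hc))
    have h2 := E2_bdd_cusp hc
    rw [OnePoint.isBoundedAt_iff_forall_SL2Z hc] at h1 h2 ⊢
    intro γ hγ
    have : phiFun N hN ∣[(2 : ℤ)] γ = (1 / ((N : ℂ) - 1)) •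
        ((E2 ∣[(2 : ℤ)] phiDiag N hN) ∣[(2 : ℤ)] γ - E2 ∣[(2 : ℤ)] γ) := by
      rw [phiFun, SL_smul_slash, sub_eq_add_neg _ E2, SlashAction.add_slash, SlashAction.neg_slash,
        ← sub_eq_add_neg]
    rw [this]
    exact ((h1 γ hγ).sub (h2 γ hγ)).const_mul_left _

lemma phiFun_tendsto (N : ℕ) (hN : 2 ≤ N) : Tendsto (phiFun N hN) atImInfty (𝓝 1) := by
  have h1 : Tendsto (fun τ : ℍ => E2 (phiDiag N hN • τ)) atImInfty (𝓝 1) :=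
    E2_tendsto.comp (tendsto_smul_atImInfty
      (by simp [phiDiag, Matrix.GeneralLinearGroup.mkOfDetNeZero]))
  have h2 := ((h1.const_mul (N : ℂ)).sub E2_tendsto).const_mul (1 / ((N : ℂ) - 1))
  have hN1 : (N : ℂ) - 1 ≠ 0 := by
    rw [sub_ne_zero]; exact_mod_cast (by omega : N ≠ 1)
  rw [mul_one, one_div_mul_cancel hN1] at h2
  refine h2.congr fun τ => ?_
  simp [phiFun, phiDiag_slash]

noncomputable def phiPair (w : ℍ) : PeriodPair where
  ω₁ := 1
  ω₂ := w
  indep := by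
    rw [LinearIndependent.pair_iff]
    intro s t h
    have hi := congrArg Complex.im h
    have hr := congrArg Complex.re h
    have hw := w.im_pos.ne'
    simp at hi hr
    have ht : t = 0 := by tauto
    subst ht
    simpa using hr

lemma wp_summable (w : ℍ) (z : ℂ) : Summable fun p : ℤ × ℤ =>
    (1 / (z - ((p.1 : ℂ) + (p.2 : ℂ) * w)) ^ 2 - 1 / ((p.1 : ℂ) + (p.2 : ℂ) * w) ^ 2) := by
  have h := ((phiPair w).hasSum_weierstrassP z).summable
  rw [← (phiPair w).latticeEquivProd.symm.toEquiv.summable_iff] at h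
  refine h.congr fun p => ?_
  have := (phiPair w).latticeEquiv_symm_apply p
  simp only [Function.comp, LinearEquiv.coe_toEquiv] at this ⊢
  rw [this]
  simp [phiPair]

lemma wpa_eq_s3 (w : ℍ) (z : ℂ) : wpa z w = (Real.pi : ℂ)⁻¹ ^ 2 * ∑' p : ℤ × ℤ,
    (1 / (z - ((p.1 : ℂ) + (p.2 : ℂ) * w)) ^ 2 - 1 / ((p.1 : ℂ) + (p.2 : ℂ) * w) ^ 2) := by
  rw [wpa, (wp_summable w z).tsum_eq_add_tsum_ite (0 : ℤ × ℤ)]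
  simp

lemma e2_hasSum (m : ℤ) (z : ℍ) : HasSum (fun n : ℤ => 1 / ((m : ℂ) * z + n) ^ 2) (e2Summand m z) := by
  have := (e2Summand_summable m z).hasSum
  simpa [eisSummand, e2Summand] using this

lemma row_hasSum (τ w : ℍ) (N k : ℕ) (hw : (w : ℂ) = N * τ) (m : ℤ) :
    HasSum (fun n : ℤ => (1 / ((k : ℂ) * τ - ((n : ℂ) + (m : ℂ) * w)) ^ 2
      - 1 / ((n : ℂ) + (m : ℂ) * w) ^ 2))
    (e2Summand (k - m * N) τ - e2Summand m w) := by
  refine HasSum.sub ?_ ?_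
  · rw [← (Equiv.neg ℤ).hasSum_iff]
    convert! e2_hasSum (k - m * N) τ using 2 with n
    simp only [Function.comp, Equiv.neg_apply, hw]
    push_cast
    congr 2
    ring
  · simpa [add_comm] using e2_hasSum m w

lemma wpa_rows (τ w : ℍ) (N k : ℕ) (hw : (w : ℂ) = N * τ) :
    HasSum (fun m : ℤ => e2Summand (k + m * N) τ - e2Summand m w)
      ((Real.pi : ℂ) ^ 2 * wpa (k * τ) w) := by
  have h0 := (wp_summable w (k * τ)).hasSum
  rw [← (Equiv.prodComm ℤ ℤ).hasSum_iff] at h0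
  have h1 := h0.prod_fiberwise (fun m => row_hasSum τ w N k hw m)
  rw [← (Equiv.neg ℤ).hasSum_iff] at h1
  rw [wpa_eq_s3]
  have hpi : (Real.pi : ℂ) ≠ 0 := by exact_mod_cast Real.pi_ne_zero
  rw [← mul_assoc, ← mul_pow, mul_inv_cancel₀ hpi, one_pow, one_mul]
  convert! h1 using 2 with m
  simp [e2Summand_even w m]

lemma e2_scale (τ w : ℍ) (N : ℕ) (hw : (w : ℂ) = N * τ) (m : ℤ) :
    e2Summand (m * N) τ = e2Summand m w := by
  rw [← (e2_hasSum m w).tsum_eq, ← (e2_hasSum (m * N) τ).tsum_eq, hw]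
  push_cast
  simp only [mul_assoc]

lemma sum_rows (f : ℤ → ℂ) (N M : ℕ) (hN : 0 < N) :
    ∑ m ∈ Finset.Ico (-(M : ℤ)) M, ∑ k ∈ Finset.range N, f (k + m * N) =
      ∑ j ∈ Finset.Ico (-((M * N : ℕ) : ℤ)) ((M * N : ℕ) : ℤ), f j := by
  rw [← Finset.sum_product']
  have hN' : (0 : ℤ) < N := by exact_mod_cast hN
  refine Finset.sum_bij' (fun p _ => (p.2 : ℤ) + p.1 * N) (fun j _ => (j / N, (j % N).toNat))
    ?_ ?_ ?_ ?_ ?_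
  · rintro ⟨m, k⟩ h
    simp only [Finset.mem_product, Finset.mem_Ico, Finset.mem_range] at h ⊢
    obtain ⟨⟨h1, h2⟩, h3⟩ := h
    have h3' : (k : ℤ) < N := by exact_mod_cast h3
    push_cast
    constructor <;> nlinarith
  · intro j h
    simp only [Finset.mem_product, Finset.mem_Ico, Finset.mem_range] at h ⊢
    push_cast at h
    have := Int.emod_nonneg j hN'.ne'
    have := Int.emod_lt_of_pos j hN'
    refine ⟨⟨?_, ?_⟩, by omega⟩
    · rw [Int.le_ediv_iff_mul_le hN']; linarith
    · rw [Int.ediv_lt_iff_lt_mul hN']; linarith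
  · rintro ⟨m, k⟩ h
    simp only [Finset.mem_product, Finset.mem_Ico, Finset.mem_range] at h
    have h3' : (k : ℤ) < N := by exact_mod_cast h.2
    have h4 : (0 : ℤ) ≤ k := by positivity
    ext
    · simp [Int.add_mul_ediv_right _ _ hN'.ne', Int.ediv_eq_zero_of_lt h4 h3']
    · simp [Int.emod_eq_of_lt h4 h3']
  · intro j h
    have := Int.emod_nonneg j hN'.ne'
    simp only [Int.toNat_of_nonneg this]
    exact Int.emod_add_ediv_mul j N
  · intro p h
    rfl

lemma sum_wpa (τ w : ℍ) (N : ℕ) (hN : 2 ≤ N) (hw : (w : ℂ) = N * τ) :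
    (Real.pi : ℂ) ^ 2 * ∑ k ∈ Finset.Icc 1 (N - 1), wpa (k * τ) w = G2 τ - N * G2 w := by
  have h1 : HasSum (fun m : ℤ => (∑ k ∈ Finset.range N, e2Summand (k + m * N) τ) - N * e2Summand m w)
      ((Real.pi : ℂ) ^ 2 * ∑ k ∈ Finset.Icc 1 (N - 1), wpa (k * τ) w) := by
    rw [Finset.mul_sum]
    have := hasSum_sum (s := Finset.Icc 1 (N - 1)) (fun k _ => wpa_rows τ w N k hw)
    convert! this using 2 with m
    have e : Finset.range N = insert 0 (Finset.Icc 1 (N - 1)) := by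
      ext x; simp; omega
    rw [e, Finset.sum_insert (by simp), Finset.sum_sub_distrib]
    simp [e2_scale τ w N hw]
    rw [Nat.cast_sub (by omega)]
    push_cast
    ring
  have h2 : Tendsto (fun M : ℕ => ∑ m ∈ Finset.Ico (-(M : ℤ)) M,
      ((∑ k ∈ Finset.range N, e2Summand (k + m * N) τ) - N * e2Summand m w)) atTop
      (𝓝 ((Real.pi : ℂ) ^ 2 * ∑ k ∈ Finset.Icc 1 (N - 1), wpa (k * τ) w)) := by
    rw [← hasSum_symmetricIco_int_iff]
    exact h1.mono_left (symmetricIco ℤ).le_atTop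
  have hG (z : ℍ) : Tendsto (fun M : ℕ => ∑ m ∈ Finset.Ico (-(M : ℤ)) M, e2Summand m z) atTop
      (𝓝 (G2 z)) := by
    have := (summable_e2Summand_symmetricIco z).hasSum
    rw [← G2_eq_tsum_symmetricIco, hasSum_symmetricIco_int_iff] at this
    exact this
  have hMN : Tendsto (fun M : ℕ => M * N) atTop atTop :=
    tendsto_id.atTop_mul_const' (by omega : 0 < N)
  have h3 := ((hG τ).comp hMN).sub ((hG w).const_mul (N : ℂ))
  refine tendsto_nhds_unique h2 (h3.congr fun M => ?_)
  simp only [Function.comp]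
  rw [Finset.sum_sub_distrib, sum_rows (fun j => e2Summand j τ) N M (by omega), Finset.mul_sum]

lemma phiFun_eq (N : ℕ) (hN : 2 ≤ N) (τ : ℍ) :
    phiFun N hN τ = -3 / ((N : ℂ) - 1) *
      ∑ k ∈ Finset.Icc 1 (N - 1), wpa ((k : ℂ) * (τ : ℂ)) ((N : ℂ) * (τ : ℂ)) := by
  have h := sum_wpa τ (phiDiag N hN • τ) N hN (phiDiag_smul N hN τ)
  rw [phiDiag_smul] at h
  have hpi : (Real.pi : ℂ) ≠ 0 := by exact_mod_cast Real.pi_ne_zero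
  have hN1 : (N : ℂ) - 1 ≠ 0 := by
    rw [sub_ne_zero]; exact_mod_cast (by omega : N ≠ 1)
  set S := ∑ k ∈ Finset.Icc 1 (N - 1), wpa ((k : ℂ) * (τ : ℂ)) ((N : ℂ) * (τ : ℂ)) with hS
  simp only [phiFun, Pi.smul_apply, Pi.sub_apply, phiDiag_slash, E2, smul_eq_mul, riemannZeta_two]
  field_simp
  linear_combination (6 : ℂ) * h

end PhiAux

open UpperHalfPlane in
/-- For `N ≥ 2`, `Φ_N(τ) = (−3/(N−1)) Σ_{k=1}^{N−1} ℘a(kτ, Nτ)` is a modular form of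
weight 2 for `Γ₀(N)`, and `Φ_N(τ) → 1` as `Im τ → +∞`. -/
theorem phiN_modularForm_and_tendsto_one (N : ℕ) (hN : 2 ≤ N) :
    (∃ f : ModularForm (CongruenceSubgroup.Gamma0 N) 2,
        ∀ τ : UpperHalfPlane,
          f τ = -3 / ((N : ℂ) - 1) *
            ∑ k ∈ Finset.Icc 1 (N - 1), wpa ((k : ℂ) * (τ : ℂ)) ((N : ℂ) * (τ : ℂ))) ∧
      Filter.Tendsto
        (fun τ : UpperHalfPlane =>
          -3 / ((N : ℂ) - 1) *
            ∑ k ∈ Finset.Icc 1 (N - 1), wpa ((k : ℂ) * (τ : ℂ)) ((N : ℂ) * (τ : ℂ)))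
        UpperHalfPlane.atImInfty (nhds 1) := by
  refine ⟨⟨phiMF N hN, fun τ => phiFun_eq N hN τ⟩, ?_⟩
  exact (phiFun_tendsto N hN).congr fun τ => phiFun_eq N hN τ
end

section
/- For every integer N ≥ 2 and every τ in the upper half-plane H, (−3/(N−1)) Σ_{k=1}^{N−1} ℘a(kτ, Nτ) = 1 − (6/(N−1)) Σ_{n=1}^{∞} 1/sin(nπτ)² + (6N/(N−1)) Σ_{n=1}^{∞} 1/sin(nπNτ)². -/
open Complex

/-- The function `1 / sin(π z)²`. -/
noncomputable def gsin (z : ℂ) : ℂ := 1 / Complex.sin (Real.pi * z) ^ 2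

lemma gsin_neg (z : ℂ) : gsin (-z) = gsin z := by
  simp [gsin]

lemma summable_inv_sq (z : ℂ) : Summable (fun n : ℤ => 1 / (z + n) ^ 2) := by
  have := EisensteinSeries.linear_right_summable z 1 (k := 2) le_rfl
  refine this.congr fun n => ?_
  simp

lemma hasSum_inv_sq_pos {z : ℂ} (hz : 0 < z.im) :
    HasSum (fun n : ℤ => 1 / (z + n) ^ 2) (Real.pi ^ 2 * gsin z) := by
  have hz' : z ∈ UpperHalfPlane.upperHalfPlaneSet := hz
  have h := iteratedDerivWithin_cot_pi_mul_eq_mul_tsum_div_pow (k := 1) le_rfl hz'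
  have hs : Complex.sin (Real.pi * z) ≠ 0 :=
    sin_pi_mul_ne_zero (UpperHalfPlane.coe_mem_integerComplement ⟨z, hz⟩)
  have hd : HasDerivAt (fun x : ℂ ↦ Real.pi * Complex.cot (Real.pi * x))
      (-(Real.pi ^ 2 * gsin z)) z := by
    have h1 : HasDerivAt (fun x : ℂ => (Real.pi : ℂ) * x) Real.pi z := by
      simpa using (hasDerivAt_id z).const_mul (Real.pi : ℂ)
    have h2 := ((h1.ccos).div h1.csin hs).const_mul (Real.pi : ℂ)
    refine h2.congr_deriv ?_
    unfold gsin
    field_simp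
    linear_combination (-1 : ℂ) * Complex.sin_sq_add_cos_sq (Real.pi * z)
  rw [iteratedDerivWithin_one, hd.hasDerivWithinAt.derivWithin
    (UpperHalfPlane.isOpen_upperHalfPlaneSet.uniqueDiffWithinAt hz')] at h
  rw [(summable_inv_sq z).hasSum_iff]
  simp at h
  simpa using h.symm

lemma hasSum_inv_sq {z : ℂ} (hz : z.im ≠ 0) :
    HasSum (fun n : ℤ => 1 / (z - n) ^ 2) (Real.pi ^ 2 * gsin z) := by
  rcases lt_or_gt_of_ne hz with h | h
  · have := hasSum_inv_sq_pos (z := -z) (by simpa using h)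
    rw [gsin_neg] at this
    convert! this using 2 with n
    congr 1; ring
  · have := hasSum_inv_sq_pos h
    rw [← (Equiv.neg ℤ).hasSum_iff] at this
    convert! this using 2 with n
    simp [sub_eq_add_neg]

lemma hasSum_even {f : ℤ → ℂ} (hf : Summable f) (he : ∀ n, f (-n) = f n) :
    HasSum f (f 0 + 2 * ∑' n : ℕ, f (n + 1)) := by
  have h1 : Summable (fun n : ℕ => f (n + 1)) :=
    hf.comp_injective (i := fun n : ℕ => (n : ℤ) + 1) (fun a b h => by simpa using h)
  have := HasSum.of_add_one_of_neg_add_one (f := f) h1.hasSum (by simpa only [he] using h1.hasSum)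
  convert! this using 1
  ring

lemma hasSum_zero_row : HasSum (fun n : ℤ => 1 / (n : ℂ) ^ 2) ((Real.pi : ℂ) ^ 2 * (1 / 3)) := by
  have hs : Summable (fun n : ℤ => 1 / (n : ℂ) ^ 2) := by simpa using summable_inv_sq 0
  have := hasSum_even hs (by simp)
  convert! this using 1
  have h2 := hasSum_zeta_two
  rw [← hasSum_nat_add_iff' 1] at h2
  have h3 := (Complex.hasSum_ofReal.mpr h2).tsum_eq
  simp at h3 ⊢
  rw [h3]
  ring

lemma im_le_norm_sin (z : ℂ) : |z.im| ≤ ‖Complex.sin z‖ := by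
  rw [← Real.sqrt_sq_eq_abs, Complex.norm_def]
  apply Real.sqrt_le_sqrt
  rw [Complex.sin_eq, Complex.normSq_apply]
  have e1 : (Complex.sin z.re * Complex.cosh z.im + Complex.cos z.re * Complex.sinh z.im * I).re
      = Real.sin z.re * Real.cosh z.im := by
    rw [← Complex.ofReal_sin, ← Complex.ofReal_cos, ← Complex.ofReal_sinh,
      ← Complex.ofReal_cosh, ← Complex.ofReal_mul, ← Complex.ofReal_mul]
    generalize Real.sin z.re * Real.cosh z.im = a
    generalize Real.cos z.re * Real.sinh z.im = b
    simp
  have e2 : (Complex.sin z.re * Complex.cosh z.im + Complex.cos z.re * Complex.sinh z.im * I).im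
      = Real.cos z.re * Real.sinh z.im := by
    rw [← Complex.ofReal_sin, ← Complex.ofReal_cos, ← Complex.ofReal_sinh,
      ← Complex.ofReal_cosh, ← Complex.ofReal_mul, ← Complex.ofReal_mul]
    generalize Real.sin z.re * Real.cosh z.im = a
    generalize Real.cos z.re * Real.sinh z.im = b
    simp
  rw [e1, e2]
  have h1 : z.im ^ 2 ≤ Real.sinh z.im ^ 2 := by
    rw [sq_le_sq, Real.abs_sinh]
    exact Real.self_le_sinh_iff.mpr (abs_nonneg _)
  have h2 := Real.sin_sq_add_cos_sq z.re
  have h3 := Real.cosh_sq z.im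
  have h4 : Real.cos z.re ^ 2 = 1 - Real.sin z.re ^ 2 := by linarith
  have h5 : Real.sin z.re * Real.cosh z.im * (Real.sin z.re * Real.cosh z.im) +
      Real.cos z.re * Real.sinh z.im * (Real.cos z.re * Real.sinh z.im) =
      Real.sin z.re ^ 2 + Real.sinh z.im ^ 2 := by
    linear_combination (Real.sin z.re ^ 2) * h3 + Real.sinh z.im ^ 2 * h4
  rw [h5]
  linarith [sq_nonneg (Real.sin z.re)]

lemma summable_gsin {τ : ℂ} (hτ : 0 < τ.im) : Summable (fun n : ℤ => gsin (n * τ)) := by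
  have h : Summable (fun n : ℤ => 1 / (Real.pi * τ.im) ^ 2 * (1 / (n : ℝ) ^ 2)) :=
    (Real.summable_one_div_int_pow.mpr (by norm_num)).mul_left _
  refine Summable.of_norm_bounded h fun n => ?_
  rcases eq_or_ne n 0 with rfl | hn
  · simp [gsin]
  have hn' : (n : ℝ) ≠ 0 := by exact_mod_cast hn
  have hpi := Real.pi_pos
  have := im_le_norm_sin (Real.pi * (n * τ))
  have him : ((Real.pi : ℂ) * (n * τ)).im = Real.pi * τ.im * n := by
    simp; ring
  rw [him] at this
  rw [gsin, norm_div, norm_pow, norm_one, one_div_mul_one_div, ← mul_pow,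
    ← sq_abs (Real.pi * τ.im * n)]
  have hpos : 0 < |Real.pi * τ.im * n| := abs_pos.mpr (by positivity)
  gcongr

lemma summable_wp (z τ : ℂ) (hτ : 0 < τ.im) : Summable (fun p : ℤ × ℤ =>
    1 / (z - ((p.1 : ℂ) + (p.2 : ℂ) * τ)) ^ 2 - 1 / ((p.1 : ℂ) + (p.2 : ℂ) * τ) ^ 2) := by
  let L : PeriodPair := ⟨1, τ, by
    rw [LinearIndependent.pair_iff]
    intro s t h
    have h1 := congrArg Complex.im h
    have h2 := congrArg Complex.re h
    simp at h1 h2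
    rcases h1 with h1 | h1
    · subst h1; simpa using h2
    · exact absurd h1 hτ.ne'⟩
  have := (L.hasSum_weierstrassP z).summable
  rw [← L.latticeEquivProd.symm.toEquiv.summable_iff] at this
  refine this.congr fun p => ?_
  have h := L.latticeEquiv_symm_apply p
  simp only [Function.comp, LinearEquiv.coe_toEquiv]
  rw [h]
  simp [L]

lemma wpa_eq_s4 (z τ : ℂ) (hτ : 0 < τ.im) (hz : ∀ m : ℤ, (z - m * τ).im ≠ 0) :
    HasSum (fun m : ℤ => gsin (z - m * τ) - gsin (m * τ) - if m = 0 then 1 / 3 else 0)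
      (wpa z τ) := by
  have h := (summable_wp z τ hτ).hasSum
  rw [← (Equiv.prodComm ℤ ℤ).hasSum_iff] at h
  have hf := h.prod_fiberwise (g := fun m : ℤ => Real.pi ^ 2 *
    (gsin (z - m * τ) - gsin (m * τ) - if m = 0 then 1 / 3 else 0)) (fun m => by
      simp only [Function.comp, Equiv.prodComm_apply, Prod.swap]
      have h1 := hasSum_inv_sq (hz m)
      have h2 : HasSum (fun n : ℤ => 1 / ((n : ℂ) + m * τ) ^ 2)
          (Real.pi ^ 2 * (gsin (m * τ) + if m = 0 then 1 / 3 else 0)) := by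
        split_ifs with hm
        · subst hm
          simpa [gsin] using hasSum_zero_row
        · have := hasSum_inv_sq (z := -(m * τ)) (by simp [hm, hτ.ne'])
          rw [gsin_neg] at this
          simp only [add_zero]
          convert! this using 2 with n
          congr 1; ring
      convert! h1.sub h2 using 1
      · funext n
        congr 3; ring
      · ring)
  have hp : (Real.pi : ℂ) ≠ 0 := by exact_mod_cast Real.pi_ne_zero
  have hm := hf.mul_left ((Real.pi : ℂ)⁻¹ ^ 2)
  convert! hm using 1
  · funext m
    rw [← mul_assoc, inv_pow, inv_mul_cancel₀ (pow_ne_zero _ hp), one_mul]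
  · rw [wpa]
    congr 1
    rw [(summable_wp z τ hτ).tsum_eq_add_tsum_ite 0]
    congr 1
    simp

lemma wpa_eq' (z τ : ℂ) (hτ : 0 < τ.im) (hz : ∀ m : ℤ, (z - m * τ).im ≠ 0) 
    (hs : Summable (fun m : ℤ => gsin (m * τ + z))) :
    wpa z τ = ∑' m : ℤ, gsin (m * τ + z) - ∑' m : ℤ, gsin (m * τ) - 1 / 3 := by
  rw [← (wpa_eq_s4 z τ hτ hz).tsum_eq]
  have h1 : HasSum (fun m : ℤ => gsin (z - m * τ)) (∑' m : ℤ, gsin (m * τ + z)) := by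
    have := hs.hasSum
    rw [← (Equiv.neg ℤ).hasSum_iff] at this
    convert! this using 2 with m
    simp; congr 1; ring
  exact ((h1.sub (summable_gsin hτ).hasSum).sub (hasSum_ite_eq 0 _)).tsum_eq

lemma tsum_gsin {τ : ℂ} (hτ : 0 < τ.im) :
    ∑' m : ℤ, gsin (m * τ) = 2 * ∑' n : ℕ, gsin ((n + 1) * τ) := by
  rw [(hasSum_even (summable_gsin hτ) (fun n => by
    rw [← gsin_neg]; congr 1; push_cast; ring)).tsum_eq]
  simp [gsin]

lemma tsum_divMod (N : ℕ) [NeZero N] {f : ℤ → ℂ} (hf : Summable f) :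
    ∑' m : ℤ, f m = ∑' m : ℤ, ∑ k ∈ Finset.range N, f (m * N + k) := by
  have h := (Int.divModEquiv N).symm.summable_iff.mpr hf
  rw [← (Int.divModEquiv N).symm.tsum_eq f]
  change ∑' c, (f ∘ (Int.divModEquiv N).symm) c = _
  rw [Summable.tsum_prod h]
  refine tsum_congr fun m => ?_
  rw [tsum_fintype, ← Fin.sum_univ_eq_sum_range (fun k => f (m * N + k))]
  rfl

/-- For `N ≥ 2` and `τ` in the upper half-plane,
`(−3/(N−1)) Σ_{k=1}^{N−1} ℘a(kτ, Nτ)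
  = 1 − (6/(N−1)) Σ_{n≥1} 1/sin(nπτ)² + (6N/(N−1)) Σ_{n≥1} 1/sin(nπNτ)²`. -/
theorem phiN_sine_series (N : ℕ) (hN : 2 ≤ N) (τ : ℂ) (hτ : 0 < τ.im) :
    -3 / ((N : ℂ) - 1) * ∑ k ∈ Finset.Icc 1 (N - 1), wpa ((k : ℂ) * τ) ((N : ℂ) * τ) =
      1 - 6 / ((N : ℂ) - 1) *
          ∑' n : ℕ, 1 / Complex.sin (((n : ℂ) + 1) * (Real.pi : ℂ) * τ) ^ 2 +
        6 * (N : ℂ) / ((N : ℂ) - 1) *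
          ∑' n : ℕ, 1 / Complex.sin (((n : ℂ) + 1) * (Real.pi : ℂ) * (N : ℂ) * τ) ^ 2 := by
  have hNτ : 0 < ((N : ℂ) * τ).im := by
    have : (0 : ℝ) < N := by exact_mod_cast (by omega : 0 < N)
    simpa using mul_pos this hτ
  have e1 : ∑' n : ℕ, 1 / Complex.sin (((n : ℂ) + 1) * (Real.pi : ℂ) * τ) ^ 2
      = ∑' n : ℕ, gsin ((n + 1) * τ) := by
    refine tsum_congr fun n => ?_
    rw [gsin]; congr 3; ring
  have e2 : ∑' n : ℕ, 1 / Complex.sin (((n : ℂ) + 1) * (Real.pi : ℂ) * (N : ℂ) * τ) ^ 2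
      = ∑' n : ℕ, gsin ((n + 1) * (N * τ)) := by
    refine tsum_congr fun n => ?_
    rw [gsin]; congr 3; ring
  have hN0 : NeZero N := ⟨by omega⟩
  have hsum : ∀ k : ℕ, Summable (fun m : ℤ => gsin (m * (N * τ) + k * τ)) := by
    intro k
    have := (summable_gsin hτ).comp_injective (i := fun m : ℤ => m * N + k) (fun a b h => by
      have : (N : ℤ) ≠ 0 := by omega
      simpa [this, hN0.ne] using h)
    refine this.congr fun m => ?_
    simp only [Function.comp]
    congr 1; push_cast; ring
  have hw : ∀ k ∈ Finset.Icc 1 (N - 1), wpa ((k : ℂ) * τ) ((N : ℂ) * τ) =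
      ∑' m : ℤ, gsin (m * (N * τ) + k * τ) -
        (∑' m : ℤ, gsin (m * (N * τ)) + 1 / 3) := by
    intro k hk
    rw [Finset.mem_Icc] at hk
    rw [wpa_eq' _ _ hNτ _ (hsum k)]
    · ring
    · intro m
      have : (k * τ - m * (N * τ)) = ((k - m * N : ℤ) : ℂ) * τ := by push_cast; ring
      rw [this]
      have h0 : (k - m * N : ℤ) ≠ 0 := by
        intro h
        have hd : (N : ℤ) ∣ k := ⟨m, by linarith⟩
        have := Nat.le_of_dvd (by omega) (Int.natCast_dvd_natCast.mp hd)
        omega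
      have him : ∀ j : ℤ, ((j : ℂ) * τ).im = j * τ.im := fun j => by simp
      rw [him]
      exact mul_ne_zero (by exact_mod_cast h0) hτ.ne'
  have hall : ∑' m : ℤ, gsin (m * τ) =
      ∑ k ∈ Finset.range N, ∑' m : ℤ, gsin (m * (N * τ) + k * τ) := by
    rw [← Summable.tsum_finsetSum (fun k _ => hsum k), tsum_divMod N (summable_gsin hτ)]
    refine tsum_congr fun m => Finset.sum_congr rfl fun k _ => ?_
    congr 1; push_cast; ring
  have hr : Finset.range N = insert 0 (Finset.Icc 1 (N - 1)) := by
    ext a; simp; omega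
  rw [hr, Finset.sum_insert (by simp)] at hall
  rw [Finset.sum_congr rfl hw, Finset.sum_sub_distrib, e1, e2]
  have hc : ((N - 1 : ℕ) : ℂ) = N - 1 := by
    rw [Nat.cast_sub (by omega)]; simp
  rw [tsum_gsin hτ] at hall
  simp only [Nat.cast_zero, zero_mul, add_zero] at hall
  rw [tsum_gsin hNτ] at hall ⊢
  rw [Finset.sum_const, Nat.card_Icc, nsmul_eq_mul, Nat.add_sub_cancel, hc]
  have hne : (N : ℂ) - 1 ≠ 0 := by
    rw [← hc]; exact_mod_cast (by omega : N - 1 ≠ 0)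
  generalize ∑ x ∈ Finset.Icc 1 (N - 1), ∑' m : ℤ, gsin (m * (N * τ) + x * τ) = A at hall ⊢
  generalize ∑' n : ℕ, gsin ((n + 1) * (N * τ)) = B at hall ⊢
  generalize ∑' n : ℕ, gsin ((n + 1) * τ) = C at hall ⊢
  field_simp
  linear_combination (3 : ℂ) * hall
end

section
/- For every τ in the upper half-plane H, ℘a(τ/(2τ+1), 2τ/(2τ+1)) = (2τ+1)² · ℘a(τ, 2τ); consequently the function τ ↦ −3℘a(τ,2τ) is a modular form of weight 2 for Γ₀(2). -/
open Complex

namespace WpaAux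

open UpperHalfPlane hiding I
open EisensteinSeries ModularForm Filter SummationFilter Matrix.SpecialLinearGroup
open scoped MatrixGroups Topology Real Manifold

/-- The point `2τ` of the upper half-plane. -/
noncomputable def dbl (τ : ℍ) : ℍ := ⟨2 * (τ : ℂ), by simpa using τ.im_pos⟩

lemma coe_dbl (τ : ℍ) : ((dbl τ : ℍ) : ℂ) = 2 * (τ : ℂ) := rfl

lemma summable_cubic (z : ℍ) : Summable fun p : ℤ × ℤ ↦
    (((p.1 : ℂ) * z + p.2) ^ 2 * (p.1 * z + p.2 + 1))⁻¹ := by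
  have H : Summable fun m : Fin 2 → ℤ ↦
      (((m 0 : ℂ) * z + m 1) ^ 2 * (m 0 * z + m 1 + 1))⁻¹ := by
    apply summable_of_isBigO_rpow_norm (a := 3) (by linarith)
    simpa [pow_three, pow_two, ← mul_assoc] using ((isBigO_linear_add_const_vec z 0 1).mul
      (isBigO_linear_add_const_vec z 0 0)).mul (isBigO_linear_add_const_vec z 0 0)
  exact (finTwoArrowEquiv _).symm.summable_iff.mpr H

/-- The row sums `e2Summand` are unconditionally summable. -/
lemma summable_e2Summand (z : ℍ) : Summable (fun m : ℤ ↦ e2Summand m z) := by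
  refine (summable_cubic z).prod.congr_cofinite ?_
  filter_upwards [eventually_cofinite_ne (0 : ℤ)] with a ha
  have hsum := summable_right_one_div_linear_sub_one_div_linear_succ z a
  have h0 := tsum_symmetricIco_linear_sub_linear_add_one_eq_zero z a
  rw [tsum_eq_of_summable_unconditional hsum] at h0
  rw [e2Summand, ← add_zero (∑' b : ℤ, (((a : ℂ) * z + b) ^ 2 * (a * z + b + 1))⁻¹), ← h0,
    ← Summable.tsum_add ((summable_cubic z).prod_factor a) hsum]
  refine tsum_congr fun n ↦ ?_
  have h1 : (a : ℂ) * z + n + 1 ≠ 0 := by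
    simpa [add_assoc] using linear_ne_zero (cd := ![a, n + 1]) z (by aesop)
  have h2 : (a : ℂ) * z + n ≠ 0 := linear_ne_zero (cd := ![a, n]) z (by aesop)
  simp only [eisSummand, Matrix.cons_val_zero, Matrix.cons_val_one, zpow_neg, zpow_ofNat]
  field_simp
  ring

lemma G2_eq_tsum (z : ℍ) : G2 z = ∑' m : ℤ, e2Summand m z := by
  rw [G2, tsum_eq_of_summable_unconditional (summable_e2Summand z)]

lemma e2Summand_dbl (z : ℍ) (m : ℤ) : e2Summand m (dbl z) = e2Summand (2 * m) z := by
  rw [e2Summand, e2Summand]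
  refine tsum_congr fun n ↦ ?_
  simp only [eisSummand, coe_dbl]
  congr 2
  simp
  ring

lemma injective_two_mul : Function.Injective (fun m : ℤ ↦ 2 * m) := fun a b h ↦ by
  simpa using h

lemma injective_odd : Function.Injective (fun m : ℤ ↦ 1 - 2 * m) := fun a b h ↦ by
  simpa using h

lemma G2_sub (z : ℍ) : G2 z - 2 * G2 (dbl z) =
    ∑' m : ℤ, (e2Summand (1 - 2 * m) z - e2Summand (2 * m) z) := by
  have hs := summable_e2Summand z
  have he : Summable fun m : ℤ ↦ e2Summand (2 * m) z := hs.comp_injective injective_two_mul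
  have ho : Summable fun m : ℤ ↦ e2Summand (1 - 2 * m) z := hs.comp_injective injective_odd
  have hsum : HasSum (fun m ↦ e2Summand m z)
      ((∑' m : ℤ, e2Summand (2 * m) z) + ∑' m : ℤ, e2Summand (1 - 2 * m) z) := by
    have h1 := injective_two_mul.hasSum_range_iff (f := fun m ↦ e2Summand m z) |>.mpr he.hasSum
    have h2 := injective_odd.hasSum_range_iff (f := fun m ↦ e2Summand m z) |>.mpr ho.hasSum
    refine h1.add_isCompl ?_ h2
    have e1 : Set.range (fun m : ℤ ↦ 2 * m) = {n | Even n} := by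
      ext n; simp only [Set.mem_range, Set.mem_ofPred_eq, even_iff_exists_two_mul, eq_comm]
    have e2 : Set.range (fun m : ℤ ↦ 1 - 2 * m) = {n | Odd n} := by
      ext n
      constructor
      · rintro ⟨m, rfl⟩
        exact ⟨-m, by ring⟩
      · rintro ⟨m, rfl⟩
        exact ⟨-m, by ring⟩
    rw [e1, e2]
    exact Int.isCompl_even_odd
  rw [G2_eq_tsum, G2_eq_tsum, hsum.tsum_eq, ho.tsum_sub he]
  simp_rw [e2Summand_dbl]
  ring

/-- The period pair `(1, 2τ)`. -/
noncomputable def pp (z : ℍ) : PeriodPair where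
  ω₁ := 1
  ω₂ := 2 * (z : ℂ)
  indep := by
    rw [LinearIndependent.pair_iff]
    intro s t h
    have him := congrArg Complex.im h
    have hre := congrArg Complex.re h
    have hz := z.im_pos.ne'
    simp at him hre
    have ht : t = 0 := by
      rcases him with h | h
      · exact h
      · exact absurd h hz
    subst ht
    simpa using hre

lemma summable_wp (z : ℍ) (w : ℂ) : Summable fun p : ℤ × ℤ ↦
    (1 / (w - ((p.1 : ℂ) + (p.2 : ℂ) * (2 * (z : ℂ)))) ^ 2 -
      1 / ((p.1 : ℂ) + (p.2 : ℂ) * (2 * (z : ℂ))) ^ 2) := by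
  have h := ((pp z).hasSum_weierstrassP w).summable
  rw [← (pp z).latticeEquivProd.symm.toEquiv.summable_iff] at h
  refine h.congr fun p ↦ ?_
  have := (pp z).latticeEquiv_symm_apply p
  simp only [Function.comp_apply, LinearEquiv.coe_toEquiv, this]
  simp [pp]

lemma wpa_eq (z : ℍ) : wpa (z : ℂ) (2 * (z : ℂ)) =
    (Real.pi : ℂ)⁻¹ ^ 2 * (G2 z - 2 * G2 (dbl z)) := by
  rw [wpa, G2_sub]
  congr 1
  have hs := summable_wp z (z : ℂ)
  set g : ℤ × ℤ → ℂ := fun p : ℤ × ℤ ↦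
    (1 / ((z : ℂ) - ((p.1 : ℂ) + (p.2 : ℂ) * (2 * (z : ℂ)))) ^ 2 -
      1 / ((p.1 : ℂ) + (p.2 : ℂ) * (2 * (z : ℂ))) ^ 2) with hg
  have h0 : 1 / (z : ℂ) ^ 2 = g 0 := by simp [hg]
  have h1 : (1 / (z : ℂ) ^ 2 + ∑' p : ℤ × ℤ, if p = 0 then 0 else g p) = ∑' p, g p := by
    rw [h0, hs.tsum_eq_add_tsum_ite 0]
  refine h1.trans ?_
  have hs' := (Equiv.prodComm ℤ ℤ).summable_iff.mpr hs
  refine ((Equiv.prodComm ℤ ℤ).tsum_eq g).symm.trans (hs'.tsum_prod.trans ?_)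
  refine tsum_congr fun m ↦ ?_
  have ho := e2Summand_summable (1 - 2 * m) z
  have ho' := (Equiv.neg ℤ).summable_iff.mpr ho
  rw [e2Summand, e2Summand,
    ← (Equiv.neg ℤ).tsum_eq (fun n ↦ eisSummand 2 ![1 - 2 * m, n] z)]
  refine Eq.trans ?_ (Summable.tsum_sub ho' (e2Summand_summable (2 * m) z))
  refine tsum_congr fun n ↦ ?_
  simp [hg, eisSummand, zpow_ofNat]
  congr 3 <;> ring

lemma G2_eq_smul_E2 : G2 = (2 * riemannZeta 2) • E2 := by
  have h : (2 * riemannZeta 2) ≠ 0 := by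
    rw [riemannZeta_two]; simp [Real.pi_ne_zero]
  rw [E2, smul_smul, mul_one_div_cancel h, one_smul]

lemma mdiff_G2 : MDiff G2 := by
  rw [G2_eq_smul_E2]
  exact E2_mdifferentiable.const_smul _

lemma isBounded_D2 (γ : SL(2, ℤ)) : IsBoundedAtImInfty (D2 γ) := by
  rw [isBoundedAtImInfty_iff]
  refine ⟨2 * π, 1, fun z hz ↦ ?_⟩
  rw [D2, norm_div, ModularGroup.denom_apply]
  have hz1 : 1 ≤ z.im := hz
  have h1 : |((γ 1 0 : ℤ) : ℝ)| * z.im ≤ ‖((γ 1 0 : ℤ) : ℂ) * (z : ℂ) + ((γ 1 1 : ℤ) : ℂ)‖ := by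
    refine le_trans (le_of_eq ?_) (Complex.abs_im_le_norm _)
    simp [abs_mul, abs_of_pos z.im_pos]
  refine div_le_of_le_mul₀ (norm_nonneg _) (by positivity) ?_
  have h2 : |((γ 1 0 : ℤ) : ℝ)| ≤ |((γ 1 0 : ℤ) : ℝ)| * z.im :=
    le_mul_of_one_le_right (abs_nonneg _) hz1
  have h3 : ‖2 * (π : ℂ) * Complex.I * ((γ 1 0 : ℤ) : ℂ)‖ = 2 * π * |((γ 1 0 : ℤ) : ℝ)| := by
    simp [abs_of_pos Real.pi_pos]
  rw [h3]
  exact mul_le_mul_of_nonneg_left (h2.trans h1) (by positivity)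

lemma isBounded_G2 : IsBoundedAtImInfty G2 := by
  rw [G2_eq_smul_E2]
  exact Filter.BoundedAtFilter.smul _ isBoundedAtImInfty_E2

lemma isBoundedAt_G2 {c : OnePoint ℝ} (hc : IsCusp c 𝒮ℒ) : c.IsBoundedAt G2 2 := by
  rw [OnePoint.isBoundedAt_iff_forall_SL2Z hc]
  intro γ _
  rw [G2_slash_action, sub_eq_add_neg]
  exact Filter.BoundedAtFilter.add isBounded_G2 (Filter.BoundedAtFilter.neg (isBounded_D2 γ))

/-- The matrix `diag(2,1)` over `ℚ`. -/
noncomputable def dq : GL (Fin 2) ℚ :=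
  Matrix.GeneralLinearGroup.mkOfDetNeZero !![2, 0; 0, 1] (by simp)

/-- The matrix `diag(2,1)` over `ℝ`. -/
noncomputable def dr : GL (Fin 2) ℝ :=
  Matrix.GeneralLinearGroup.mkOfDetNeZero !![2, 0; 0, 1] (by simp)

lemma map_dq : Matrix.GeneralLinearGroup.map (Rat.castHom ℝ) dq = dr := by
  ext i j
  fin_cases i <;> fin_cases j <;>
    simp [dq, dr, Matrix.GeneralLinearGroup.mkOfDetNeZero]

lemma isCusp_dr {c : OnePoint ℝ} (hc : IsCusp c 𝒮ℒ) : IsCusp (dr • c) 𝒮ℒ := by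
  rw [isCusp_SL2Z_iff] at hc ⊢
  obtain ⟨x, rfl⟩ := hc
  refine ⟨dq • x, ?_⟩
  rw [← Rat.coe_castHom, OnePoint.map_smul, map_dq]

lemma dr_det : dr.det.val = 2 := by
  simp [dr, Matrix.GeneralLinearGroup.mkOfDetNeZero]

lemma dr_smul (z : ℍ) : dr • z = dbl z := by
  ext
  rw [UpperHalfPlane.coe_smul_of_det_pos (by rw [dr_det]; norm_num), coe_dbl]
  simp [num, denom, dr, Matrix.GeneralLinearGroup.mkOfDetNeZero]

lemma slash_dr (f : ℍ → ℂ) (z : ℍ) : (f ∣[(2 : ℤ)] dr) z = 2 * f (dbl z) := by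
  rw [ModularForm.slash_apply, dr_smul, dr_det]
  have : σ dr = ContinuousAlgEquiv.refl ℝ ℂ := by
    rw [σ, if_pos]
    rw [dr_det]; norm_num
  rw [this]
  simp [denom, dr, Matrix.GeneralLinearGroup.mkOfDetNeZero]
  ring

/-- `G2(τ) - 2 G2(2τ)`. -/
noncomputable def F : ℍ → ℂ := G2 - G2 ∣[(2 : ℤ)] dr

lemma F_apply (z : ℍ) : F z = G2 z - 2 * G2 (dbl z) := by
  simp [F, slash_dr]

lemma F_bdd {c : OnePoint ℝ} (hc : IsCusp c 𝒮ℒ) : c.IsBoundedAt F 2 := by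
  have h := OnePoint.IsBoundedAt.smul_iff.mp (isBoundedAt_G2 (isCusp_dr hc))
  rw [F]
  intro g hg
  rw [sub_eq_add_neg, SlashAction.add_slash, SlashAction.neg_slash]
  exact Filter.BoundedAtFilter.add (isBoundedAt_G2 hc g hg) (Filter.BoundedAtFilter.neg (h g hg))

lemma F_mdiff : MDiff F := mdiff_G2.sub (mdiff_G2.slash 2 dr)

lemma F_slash (γ : SL(2, ℤ)) (hγ : γ ∈ CongruenceSubgroup.Gamma0 2) :
    F ∣[(2 : ℤ)] γ = F := by
  rw [CongruenceSubgroup.Gamma0_mem] at hγ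
  obtain ⟨c, hc⟩ : (2 : ℤ) ∣ γ 1 0 := (ZMod.intCast_zmod_eq_zero_iff_dvd _ _).mp hγ
  have hdet := γ.det_coe
  rw [Matrix.det_fin_two] at hdet
  obtain ⟨γ', h00, h01, h10, h11⟩ : ∃ g : SL(2, ℤ), g 0 0 = γ 0 0 ∧ g 0 1 = 2 * γ 0 1 ∧
      g 1 0 = c ∧ g 1 1 = γ 1 1 := by
    refine ⟨⟨!![γ 0 0, 2 * γ 0 1; c, γ 1 1], ?_⟩, rfl, rfl, rfl, rfl⟩
    rw [Matrix.det_fin_two_of]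
    rw [hc] at hdet
    linarith
  have hcomm : dr * (mapGL ℝ γ) = (mapGL ℝ γ') * dr := by
    ext i j
    fin_cases i <;> fin_cases j <;>
      simp [dr, Matrix.GeneralLinearGroup.mkOfDetNeZero, Matrix.mul_apply, hc, h00, h01, h10,
        h11, mul_comm]
  have hD : D2 γ' ∣[(2 : ℤ)] dr = D2 γ := by
    ext z
    rw [slash_dr, D2, D2, ModularGroup.denom_apply, ModularGroup.denom_apply, coe_dbl, h10, h11,
      hc]
    push_cast
    ring_nf
  have h2 : (G2 ∣[(2 : ℤ)] dr) ∣[(2 : ℤ)] γ = G2 ∣[(2 : ℤ)] dr - D2 γ := by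
    have : (G2 ∣[(2 : ℤ)] dr) ∣[(2 : ℤ)] (mapGL ℝ γ) = (G2 ∣[(2 : ℤ)] (mapGL ℝ γ')) ∣[(2 : ℤ)] dr := by
      rw [← SlashAction.slash_mul, ← SlashAction.slash_mul, hcomm]
    refine Eq.trans this ?_
    have h3 : G2 ∣[(2 : ℤ)] (mapGL ℝ γ') = G2 - D2 γ' := G2_slash_action γ'
    rw [h3, sub_eq_add_neg, SlashAction.add_slash, SlashAction.neg_slash, hD, ← sub_eq_add_neg]
  rw [F, sub_eq_add_neg, SlashAction.add_slash, SlashAction.neg_slash, h2, G2_slash_action]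
  abel

/-- The modular form `F`. -/
noncomputable def FM : ModularForm (CongruenceSubgroup.Gamma0 2) 2 where
  toFun := F
  slash_action_eq' A hA := by
    obtain ⟨A, hA, rfl⟩ := hA
    exact F_slash A hA
  holo' := F_mdiff
  bdd_at_cusps' {c} hc := by
    rw [Subgroup.IsArithmetic.isCusp_iff_isCusp_SL2Z] at hc
    exact F_bdd hc

lemma F_special (z : ℍ) : ∃ w : ℍ, (w : ℂ) = (z : ℂ) / (2 * (z : ℂ) + 1) ∧
    F w = (2 * (z : ℂ) + 1) ^ 2 * F z := by
  let γ : SL(2, ℤ) := ⟨!![1, 0; 2, 1], by simp⟩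
  have hγ : γ ∈ CongruenceSubgroup.Gamma0 2 := by
    rw [CongruenceSubgroup.Gamma0_mem]
    exact (ZMod.intCast_zmod_eq_zero_iff_dvd _ _).mpr (dvd_refl 2)
  have h := congrFun (F_slash γ hγ) z
  have hd : denom γ z = 2 * (z : ℂ) + 1 := by
    rw [ModularGroup.denom_apply]; simp [γ]
  have hne : (2 * (z : ℂ) + 1) ≠ 0 := hd ▸ denom_ne_zero γ z
  refine ⟨γ • z, ?_, ?_⟩
  · rw [UpperHalfPlane.specialLinearGroup_apply]
    simp [γ]
  · rw [SL_slash_apply, hd] at h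
    rw [← h]
    simp only [zpow_neg, zpow_ofNat]
    field_simp

end WpaAux

open UpperHalfPlane in
/-- `℘a(τ/(2τ+1), 2τ/(2τ+1)) = (2τ+1)² ℘a(τ, 2τ)`; consequently
`τ ↦ −3℘a(τ,2τ)` is a modular form of weight 2 for `Γ₀(2)`. -/
theorem wpa_gamma0_two :
    (∀ τ : ℂ, 0 < τ.im →
        wpa (τ / (2 * τ + 1)) (2 * τ / (2 * τ + 1)) = (2 * τ + 1) ^ 2 * wpa τ (2 * τ)) ∧
      ∃ f : ModularForm (CongruenceSubgroup.Gamma0 2) 2,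
        ∀ τ : UpperHalfPlane, f τ = -3 * wpa (τ : ℂ) (2 * (τ : ℂ)) := by
  have key : ∀ z : UpperHalfPlane, wpa (z : ℂ) (2 * (z : ℂ)) =
      (Real.pi : ℂ)⁻¹ ^ 2 * WpaAux.F z := fun z ↦ by rw [WpaAux.wpa_eq, WpaAux.F_apply]
  refine ⟨fun τ hτ ↦ ?_, (-3 * (Real.pi : ℂ)⁻¹ ^ 2) • WpaAux.FM, fun τ ↦ ?_⟩
  · obtain ⟨w, hw, hF⟩ := WpaAux.F_special ⟨τ, hτ⟩
    have h1 := key w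
    have h2 := key ⟨τ, hτ⟩
    simp only [hw] at h1
    rw [show 2 * τ / (2 * τ + 1) = 2 * (τ / (2 * τ + 1)) by ring]
    refine h1.trans ?_
    refine Eq.trans ?_ (congrArg (fun x ↦ (2 * τ + 1) ^ 2 * x) h2).symm
    rw [hF]
    ring
  · rw [key]
    have : ((-3 * (Real.pi : ℂ)⁻¹ ^ 2) • WpaAux.FM) τ =
      (-3 * (Real.pi : ℂ)⁻¹ ^ 2) * WpaAux.F τ := rfl
    rw [this]
    ring
end

section
/- For every τ in the upper half-plane H, ℘̃a(1/2, 2τ/(4τ+1)) = (4τ+1)² · ℘̃a(1/2, 2τ); consequently the function τ ↦ ℘̃a(1/2, 2τ) is a modular form of weight 2 for Γ₀(4). -/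
open Complex

namespace WptAux

open EisensteinSeries UpperHalfPlane SummationFilter

/-- Splitting a sum over `ℤ` into even and odd parts. -/
lemma tsum_int_even_odd {f : ℤ → ℂ} (hf : Summable f) :
    ∑' m : ℤ, f (2 * m + 1) = ∑' m, f m - ∑' m : ℤ, f (2 * m) := by
  have he : Function.Injective (fun m : ℤ ↦ 2 * m) := fun a b h ↦ by simpa using h
  have ho : Function.Injective (fun m : ℤ ↦ 2 * m + 1) := fun a b h ↦ by simpa using h
  have hc : IsCompl (Set.range (fun m : ℤ ↦ 2 * m)) (Set.range (fun m : ℤ ↦ 2 * m + 1)) := by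
    rw [range_two_mul, range_two_mul_add_one]
    exact Int.isCompl_even_odd
  have h1 := (he.hasSum_range_iff (f := f)).mpr (hf.comp_injective he).hasSum
  have h2 := (ho.hasSum_range_iff (f := f)).mpr (hf.comp_injective ho).hasSum
  have := (h1.add_isCompl hc h2).tsum_eq
  simp only [Function.comp_def] at this
  rw [this]; ring

/-- Correction term (compare the proof of the transformation law of `G2` in Mathlib). -/
noncomputable def dl (x : Fin 2 → ℤ) : ℂ := if x = ![0, 0] then 1 else if x = ![0, -1] then 2 else 0

lemma dl_eventually_cofinite : dl =ᶠ[Filter.cofinite] 0 := by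
  filter_upwards [Filter.eventually_cofinite_ne ![0, 0],
    Filter.eventually_cofinite_ne ![0, -1]] with x hx hx'
  simp_all [dl]

/-- An absolutely convergent variant of the summand of `G2`. -/
noncomputable abbrev gTerm (z : ℍ) (m : Fin 2 → ℤ) : ℂ :=
    (((m 0 : ℂ) * z + m 1) ^ 2 * (m 0 * z + m 1 + 1))⁻¹ + dl m

lemma gTerm_summable (z : ℍ) : Summable (gTerm z) := by
  have H : Summable fun m ↦ gTerm z m - dl m := by
    simp_rw [gTerm, add_sub_cancel_right]
    apply summable_of_isBigO_rpow_norm (a := 3) (by linarith)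
    simpa [pow_three, pow_two, ← mul_assoc] using ((isBigO_linear_add_const_vec z 0 1).mul
      (isBigO_linear_add_const_vec z 0 0)).mul (isBigO_linear_add_const_vec z 0 0)
  exact H.congr_cofinite <| dl_eventually_cofinite.mp <| .of_forall <| by simp +contextual

lemma gTerm_prod_summable (z : ℍ) : Summable (fun p : ℤ × ℤ ↦ gTerm z ![p.1, p.2]) := by
  apply (finTwoArrowEquiv _).symm.summable_iff.mpr (gTerm_summable z)

lemma gTerm_identity (z : ℍ) (b n : ℤ) : ((b : ℂ) * z + n + 1)⁻¹ * (((b : ℂ) * z + n) ^ 2)⁻¹ +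
    (dl ![b, n]) + (((b : ℂ) * z + n)⁻¹ - ((b : ℂ) * z + n + 1)⁻¹) = (((b : ℂ) * z + n) ^ 2)⁻¹ := by
  by_cases h : b = 0 ∧ n = 0
  · simp [h.1, h.2, dl]
  · simp only [not_and] at h
    by_cases hb : b = 0
    · by_cases hn : n = -1
      · simp [hb, hn, dl]
        ring
      · have hn0 : (n : ℂ) ≠ 0 := by aesop
        have hn1 : (n : ℂ) + 1 ≠ 0 := by norm_cast; grind
        simp [dl, h, hb, hn]
        grind
    · have h0 : (b : ℂ) * z + n + 1 ≠ 0 := by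
        simpa [add_assoc] using linear_ne_zero (cd := ![b, n + 1]) z (by aesop)
      have h1 : (b : ℂ) * z + n ≠ 0 := linear_ne_zero (cd := ![b, n]) z (by aesop)
      simp [dl]
      grind

lemma e2Summand_eq (z : ℍ) (a : ℤ) : e2Summand a z = ∑' n, gTerm z ![a, n] := by
  have h0 := tsum_symmetricIco_linear_sub_linear_add_one_eq_zero z a
  rw [tsum_eq_of_summable_unconditional
        (summable_right_one_div_linear_sub_one_div_linear_succ z a)] at h0
  rw [← add_zero (∑' n, gTerm z ![a, n]), ← h0, e2Summand, ← Summable.tsum_add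
        ((gTerm_prod_summable z).prod_factor _)
        (summable_right_one_div_linear_sub_one_div_linear_succ z a)]
  exact tsum_congr (fun b ↦ by simp [eisSummand, gTerm, gTerm_identity z a b, zpow_ofNat])

lemma summable_e2 (z : ℍ) : Summable (fun m ↦ e2Summand m z) := by
  simp_rw [e2Summand_eq]
  exact (gTerm_prod_summable z).prod

lemma G2_eq (z : ℍ) : G2 z = ∑' m, e2Summand m z := by
  rw [G2]
  exact tsum_eq_of_summable_unconditional (summable_e2 z)

/-- `N z` as a point of the upper half plane. -/
noncomputable def dil (N : ℕ) [NeZero N] (z : ℍ) : ℍ :=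
  ⟨N * (z : ℂ), by
    have : 0 < N := Nat.pos_of_ne_zero (NeZero.ne N)
    simpa using mul_pos (by exact_mod_cast this) z.im_pos⟩

lemma coe_dil (N : ℕ) [NeZero N] (z : ℍ) : (dil N z : ℂ) = N * (z : ℂ) := rfl

lemma e2_def (m : ℤ) (z : ℍ) : e2Summand m z = ∑' n : ℤ, 1 / ((m : ℂ) * z + n) ^ 2 := by
  simp [e2Summand, eisSummand, zpow_ofNat]

lemma summable_inner (x : ℂ) : Summable (fun n : ℤ ↦ 1 / (x + n) ^ 2) := by
  have := linear_right_summable x 1 (k := 2) le_rfl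
  simpa [zpow_ofNat] using this

lemma e2_dil (m : ℤ) (z : ℍ) : e2Summand m (dil 2 z) = e2Summand (2 * m) z := by
  rw [e2_def, e2_def]
  refine tsum_congr fun n ↦ ?_
  rw [coe_dil]; push_cast; ring_nf

lemma dil_dil (z : ℍ) : dil 2 (dil 2 z) = dil 4 z := by
  apply UpperHalfPlane.ext
  simp only [coe_dil]; push_cast; ring

lemma sum_odd (z : ℍ) : ∑' m : ℤ, e2Summand (2 * m + 1) z = G2 z - G2 (dil 2 z) := by
  rw [tsum_int_even_odd (summable_e2 z), G2_eq, G2_eq]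
  simp_rw [e2_dil]

/-- The inner sums. -/
lemma inner_half (x : ℂ) : ∑' n : ℤ, 1 / ((n : ℂ) + 1 / 2 + x) ^ 2 =
    4 * ∑' n : ℤ, 1 / (2 * x + n) ^ 2 - ∑' n : ℤ, 1 / (x + n) ^ 2 := by
  have h := tsum_int_even_odd (summable_inner (2 * x))
  have h1 : ∑' n : ℤ, 1 / ((n : ℂ) + 1 / 2 + x) ^ 2 =
      4 * ∑' m : ℤ, 1 / (2 * x + ((2 * m + 1 : ℤ) : ℂ)) ^ 2 := by
    rw [← tsum_mul_left]
    refine tsum_congr fun n ↦ ?_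
    have : 2 * x + ((2 * n + 1 : ℤ) : ℂ) = 2 * ((n : ℂ) + 1 / 2 + x) := by push_cast; ring
    rw [this, mul_pow]; norm_num
    ring
  have h2 : ∑' n : ℤ, 1 / (x + n) ^ 2 = 4 * ∑' m : ℤ, 1 / (2 * x + ((2 * m : ℤ) : ℂ)) ^ 2 := by
    rw [← tsum_mul_left]
    refine tsum_congr fun n ↦ ?_
    have : 2 * x + ((2 * n : ℤ) : ℂ) = 2 * (x + n) := by push_cast; ring
    rw [this, mul_pow]; norm_num
    ring
  rw [h1, h2, h]; ring

lemma inner_shift (x : ℂ) : ∑' n : ℤ, 1 / (1 / 2 + ((n : ℂ) + 1 / 2) + x) ^ 2 =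
    ∑' n : ℤ, 1 / (x + n) ^ 2 := by
  rw [← (Equiv.addRight (1 : ℤ)).tsum_eq (fun n : ℤ ↦ 1 / (x + n) ^ 2)]
  refine tsum_congr fun n ↦ ?_
  simp only [Equiv.coe_addRight]; push_cast; congr 2; ring

lemma summable_half (x : ℂ) : Summable (fun n : ℤ ↦ 1 / ((n : ℂ) + 1 / 2 + x) ^ 2) := by
  refine (summable_inner (1 / 2 + x)).congr fun n ↦ ?_
  congr 2; ring

lemma summable_shift (x : ℂ) :
    Summable (fun n : ℤ ↦ 1 / (1 / 2 + ((n : ℂ) + 1 / 2) + x) ^ 2) := by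
  refine (summable_inner (1 + x)).congr fun n ↦ ?_
  congr 2; ring

lemma inner_sum (z : ℍ) (m : ℤ) :
    ∑' n : ℤ, (1 / (1 / 2 + ((n : ℂ) + 1 / 2) + ((m : ℂ) + 1 / 2) * (2 * z)) ^ 2 -
        1 / (((n : ℂ) + 1 / 2) + ((m : ℂ) + 1 / 2) * (2 * z)) ^ 2) =
      2 * e2Summand (2 * m + 1) z - 4 * e2Summand (2 * m + 1) (dil 2 z) := by
  rw [Summable.tsum_sub (summable_shift _) (summable_half _), inner_shift, inner_half, e2_def,
    e2_def, coe_dil]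
  have h1 : ((2 * m + 1 : ℤ) : ℂ) * z = ((m : ℂ) + 1 / 2) * (2 * z) := by push_cast; ring
  have h2 : ((2 * m + 1 : ℤ) : ℂ) * (((2 : ℕ) : ℂ) * z) = 2 * (((m : ℂ) + 1 / 2) * (2 * z)) := by
    push_cast; ring
  rw [h1, h2]; ring

lemma term_bound (a b : ℂ) (ha : a ≠ 0) (hb : b ≠ 0) :
    ‖1 / a ^ 2 - 1 / b ^ 2‖ ≤ 2 * ‖b - a‖ * (‖a ^ 3‖⁻¹ + ‖b ^ 3‖⁻¹) := by
  have h : 1 / a ^ 2 - 1 / b ^ 2 = (b - a) * (a⁻¹ ^ 2 * b⁻¹ + a⁻¹ * b⁻¹ ^ 2) := by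
    field_simp; ring
  rw [h, norm_mul, mul_comm 2, mul_assoc]
  gcongr
  refine (norm_add_le _ _).trans ?_
  simp only [norm_mul, norm_pow, norm_inv]
  have hx : 0 ≤ ‖a‖⁻¹ := by positivity
  have hy : 0 ≤ ‖b‖⁻¹ := by positivity
  rw [← inv_pow, ← inv_pow]
  generalize ‖a‖⁻¹ = x at *
  generalize ‖b‖⁻¹ = y at *
  nlinarith [mul_nonneg (add_nonneg hx hy) (sq_nonneg (x - y)), pow_nonneg hx 3, pow_nonneg hy 3]

lemma summable_main (z : ℍ) : Summable (fun p : ℤ × ℤ ↦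
    (1 / (1 / 2 + ((p.1 : ℂ) + 1 / 2) + ((p.2 : ℂ) + 1 / 2) * (2 * z)) ^ 2 -
        1 / (((p.1 : ℂ) + 1 / 2) + ((p.2 : ℂ) + 1 / 2) * (2 * z)) ^ 2)) := by
  have i1 : Function.Injective (fun p : ℤ × ℤ ↦ ((2 * p.2 + 1, p.1 + 1) : ℤ × ℤ)) := by
    rintro ⟨a, b⟩ ⟨c, d⟩ h; simp at h ⊢; tauto
  have i2 : Function.Injective (fun p : ℤ × ℤ ↦ ((2 * p.2 + 1, 2 * p.1 + 1) : ℤ × ℤ)) := by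
    rintro ⟨a, b⟩ ⟨c, d⟩ h; simp at h ⊢; tauto
  have s1 := ((summable_prod_eisSummand (k := 3) le_rfl z).comp_injective i1).norm
  have s2 := ((summable_prod_eisSummand (k := 3) le_rfl (dil 2 z)).comp_injective i2).norm
  refine Summable.of_norm_bounded (s1.add (s2.mul_left 8)) ?_
  rintro ⟨n, m⟩
  have e1 : 1 / 2 + ((n : ℂ) + 1 / 2) + ((m : ℂ) + 1 / 2) * (2 * z) =
      ((2 * m + 1 : ℤ) : ℂ) * z + ((n + 1 : ℤ) : ℂ) := by push_cast; ring
  have e2 : ((n : ℂ) + 1 / 2) + ((m : ℂ) + 1 / 2) * (2 * z) =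
      (((2 * m + 1 : ℤ) : ℂ) * (dil 2 z) + ((2 * n + 1 : ℤ) : ℂ)) / 2 := by
    rw [coe_dil]; push_cast; ring
  have n1 : ((2 * m + 1 : ℤ) : ℂ) * z + ((n + 1 : ℤ) : ℂ) ≠ 0 := by
    simpa using linear_ne_zero (cd := ![((2 * m + 1 : ℤ) : ℝ), ((n + 1 : ℤ) : ℝ)]) z (by
      intro h
      have := congrFun h 0
      simp only [Matrix.cons_val_zero, Pi.zero_apply, Int.cast_eq_zero] at this
      omega)
  have n2 : ((2 * m + 1 : ℤ) : ℂ) * (dil 2 z) + ((2 * n + 1 : ℤ) : ℂ) ≠ 0 := by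
    simpa using linear_ne_zero (cd := ![((2 * m + 1 : ℤ) : ℝ), ((2 * n + 1 : ℤ) : ℝ)]) (dil 2 z) (by
      intro h
      have := congrFun h 0
      simp only [Matrix.cons_val_zero, Pi.zero_apply, Int.cast_eq_zero] at this
      omega)
  have hb := term_bound _ _ n1 (div_ne_zero n2 two_ne_zero)
  have hd : (((2 * m + 1 : ℤ) : ℂ) * (dil 2 z) + ((2 * n + 1 : ℤ) : ℂ)) / 2 -
      (((2 * m + 1 : ℤ) : ℂ) * z + ((n + 1 : ℤ) : ℂ)) = -(1 / 2) := by
    rw [coe_dil]; push_cast; ring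
  rw [hd] at hb
  dsimp only
  rw [e1, e2]
  refine hb.trans (le_of_eq ?_)
  simp only [Function.comp, eisSummand, Matrix.cons_val_zero, Matrix.cons_val_one,
    Matrix.cons_val_fin_one, div_pow, norm_div, norm_pow, norm_neg, zpow_neg, norm_inv,
    Nat.cast_ofNat, zpow_ofNat, norm_one, Complex.norm_ofNat]
  rw [inv_div]
  ring

lemma wpt_eq_G2 (z : ℍ) : wpt (1 / 2) (2 * (z : ℂ)) =
    (Real.pi : ℂ)⁻¹ ^ 2 * (2 * G2 z - 6 * G2 (dil 2 z) + 4 * G2 (dil 4 z)) := by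
  have hs := summable_main z
  have hs' := hs.prod_symm
  rw [wpt, ← (Equiv.prodComm ℤ ℤ).tsum_eq]
  simp only [Equiv.prodComm_apply, Prod.fst_swap, Prod.snd_swap]
  congr 1
  have h := hs'.tsum_prod
  simp only [Prod.fst_swap, Prod.snd_swap] at h
  rw [h]
  simp_rw [inner_sum]
  have ho : Function.Injective (fun m : ℤ ↦ 2 * m + 1) := fun a b h ↦ by simpa using h
  have a1 := ((summable_e2 z).comp_injective ho).mul_left 2
  have a2 := ((summable_e2 (dil 2 z)).comp_injective ho).mul_left 4
  simp only [Function.comp_def] at a1 a2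
  rw [Summable.tsum_sub a1 a2, tsum_mul_left, tsum_mul_left, sum_odd, sum_odd, dil_dil]
  ring

lemma wpt_eq_E2 (z : ℍ) : wpt (1 / 2) (2 * (z : ℂ)) =
    2 / 3 * E2 z - 2 * E2 (dil 2 z) + 4 / 3 * E2 (dil 4 z) := by
  rw [wpt_eq_G2]
  simp only [E2, Pi.smul_apply, smul_eq_mul, riemannZeta_two]
  have : (Real.pi : ℂ) ≠ 0 := by exact_mod_cast Real.pi_ne_zero
  field_simp
  ring

open scoped MatrixGroups ModularForm

open Matrix.SpecialLinearGroup (mapGL)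

/-- The rational matrix `diag(N, 1)`. -/
noncomputable def matQ (N : ℕ) [NeZero N] : GL (Fin 2) ℚ :=
  Matrix.GeneralLinearGroup.mkOfDetNeZero !![(N : ℚ), 0; 0, 1] (by
    simpa [Matrix.det_fin_two] using NeZero.ne N)

/-- The real matrix `diag(N, 1)`. -/
noncomputable def matR (N : ℕ) [NeZero N] : GL (Fin 2) ℝ :=
  (matQ N).map (Rat.castHom ℝ)

lemma matR_coe (N : ℕ) [NeZero N] :
    ((matR N : GL (Fin 2) ℝ) : Matrix (Fin 2) (Fin 2) ℝ) = !![(N : ℝ), 0; 0, 1] := by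
  ext i j
  fin_cases i <;> fin_cases j <;>
    simp [matR, matQ, Matrix.GeneralLinearGroup.mkOfDetNeZero]

lemma matR_det (N : ℕ) [NeZero N] : (matR N).det.val = N := by
  rw [Matrix.GeneralLinearGroup.val_det_apply, matR_coe]
  simp [Matrix.det_fin_two]

lemma matR_det_pos (N : ℕ) [NeZero N] : 0 < (matR N).det.val := by
  rw [matR_det]
  exact_mod_cast Nat.pos_of_ne_zero (NeZero.ne N)

lemma matR_smul (N : ℕ) [NeZero N] (z : ℍ) : matR N • z = dil N z := by
  apply UpperHalfPlane.ext
  rw [UpperHalfPlane.coe_smul_of_det_pos (matR_det_pos N), coe_dil]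
  simp [num, denom, matR_coe]

lemma slash_matR (N : ℕ) [NeZero N] (f : ℍ → ℂ) (z : ℍ) :
    (f ∣[(2 : ℤ)] matR N) z = N * f (dil N z) := by
  rw [ModularForm.slash_apply, matR_smul, matR_det]
  have h : UpperHalfPlane.σ (matR N) = ContinuousAlgEquiv.refl ℝ ℂ := by
    rw [UpperHalfPlane.σ, if_pos (matR_det_pos N)]
  rw [h]
  simp [denom, matR_coe]
  ring

lemma matR_cusp (N : ℕ) [NeZero N] {c : OnePoint ℝ} (hc : IsCusp c 𝒮ℒ) :
    IsCusp (matR N • c) 𝒮ℒ := by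
  rw [isCusp_SL2Z_iff] at hc ⊢
  obtain ⟨q, rfl⟩ := hc
  refine ⟨matQ N • q, ?_⟩
  rw [← Rat.coe_castHom, OnePoint.map_smul]
  rfl

lemma D2_bdd (γ : SL(2, ℤ)) : IsBoundedAtImInfty (D2 γ) := by
  rw [UpperHalfPlane.isBoundedAtImInfty_iff]
  by_cases hc : γ 1 0 = 0
  · exact ⟨0, 0, fun z _ ↦ by simp [D2, hc]⟩
  · refine ⟨‖(2 * Real.pi * Complex.I * γ 1 0 : ℂ)‖, 1, fun z hz ↦ ?_⟩
    rw [D2, norm_div]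
    refine div_le_self (norm_nonneg _) ?_
    have h1 : (1 : ℝ) ≤ |(γ 1 0 : ℝ)| := by
      exact_mod_cast Int.one_le_abs hc
    have h2 : (denom γ z).im = γ 1 0 * z.im := by
      simp [ModularGroup.denom_apply]
    calc (1 : ℝ) ≤ |(γ 1 0 : ℝ)| * |z.im| := by
          rw [abs_of_pos z.im_pos]; nlinarith
      _ = |(denom γ z).im| := by rw [h2, abs_mul]
      _ ≤ _ := Complex.abs_im_le_norm _

lemma E2_bdd_cusp {c : OnePoint ℝ} (hc : IsCusp c 𝒮ℒ) : c.IsBoundedAt E2 2 := by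
  rw [OnePoint.isBoundedAt_iff_forall_SL2Z hc]
  intro γ _
  rw [E2_slash_action]
  have h := (D2_bdd γ).const_mul_left (1 / (2 * riemannZeta 2))
  exact isBoundedAtImInfty_E2.sub h

lemma E2_matR_bdd_cusp (N : ℕ) [NeZero N] {c : OnePoint ℝ} (hc : IsCusp c 𝒮ℒ) :
    c.IsBoundedAt (E2 ∣[(2 : ℤ)] matR N) 2 := by
  rw [← OnePoint.IsBoundedAt.smul_iff]
  exact E2_bdd_cusp (matR_cusp N hc)

lemma smul_bdd {c : OnePoint ℝ} {f : ℍ → ℂ} (a : ℝ) (h : c.IsBoundedAt f 2) :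
    c.IsBoundedAt ((a : ℂ) • f) 2 := by
  intro g hg
  rw [ModularForm.smul_slash]
  exact (h g hg).const_mul_left _

/-- The conjugate of `γ` by `diag(N,1)`. -/
def conjSL (N : ℕ) (γ : SL(2, ℤ)) (e : ℤ) (h : γ 1 0 = N * e) : SL(2, ℤ) :=
  ⟨!![γ 0 0, N * γ 0 1; e, γ 1 1], by
    have := γ.det_coe
    rw [Matrix.det_fin_two] at this
    rw [Matrix.det_fin_two_of]
    rw [h] at this
    linarith⟩

lemma conjSL_00 (N : ℕ) (γ : SL(2, ℤ)) (e : ℤ) (h : γ 1 0 = N * e) :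
    conjSL N γ e h 0 0 = γ 0 0 := rfl

lemma conjSL_01 (N : ℕ) (γ : SL(2, ℤ)) (e : ℤ) (h : γ 1 0 = N * e) :
    conjSL N γ e h 0 1 = N * γ 0 1 := rfl

lemma conjSL_10 (N : ℕ) (γ : SL(2, ℤ)) (e : ℤ) (h : γ 1 0 = N * e) :
    conjSL N γ e h 1 0 = e := rfl

lemma conjSL_11 (N : ℕ) (γ : SL(2, ℤ)) (e : ℤ) (h : γ 1 0 = N * e) :
    conjSL N γ e h 1 1 = γ 1 1 := rfl

lemma mapGL_slash (f : ℍ → ℂ) (γ : SL(2, ℤ)) :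
    f ∣[(2 : ℤ)] (mapGL ℝ γ) = f ∣[(2 : ℤ)] γ := rfl

lemma matR_mul (N : ℕ) [NeZero N] (γ : SL(2, ℤ)) (e : ℤ) (h : γ 1 0 = N * e) :
    matR N * mapGL ℝ γ = mapGL ℝ (conjSL N γ e h) * matR N := by
  ext i j
  rw [Matrix.GeneralLinearGroup.coe_mul, Matrix.GeneralLinearGroup.coe_mul, matR_coe]
  fin_cases i <;> fin_cases j <;>
    simp [Matrix.mul_apply, Fin.sum_univ_two, conjSL_00, conjSL_01, conjSL_10, conjSL_11, h, mul_comm]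

lemma E2_matR_slash (N : ℕ) [NeZero N] (γ : SL(2, ℤ)) (h : (N : ℤ) ∣ γ 1 0) :
    (E2 ∣[(2 : ℤ)] matR N) ∣[(2 : ℤ)] γ =
      E2 ∣[(2 : ℤ)] matR N - (1 / (2 * riemannZeta 2)) • D2 γ := by
  obtain ⟨e, he⟩ := h
  rw [← mapGL_slash, ← SlashAction.slash_mul, matR_mul N γ e he, SlashAction.slash_mul,
    mapGL_slash, E2_slash_action]
  ext z
  have hN : (N : ℂ) ≠ 0 := by exact_mod_cast NeZero.ne N
  simp only [slash_matR, Pi.sub_apply, Pi.smul_apply, smul_eq_mul, D2]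
  rw [ModularGroup.denom_apply, ModularGroup.denom_apply, coe_dil]
  simp only [conjSL_10, conjSL_11, he]
  simp
  ring_nf

/-- The form in terms of slashes of `E2`. -/
noncomputable def F : ℍ → ℂ :=
  ((2 / 3 : ℝ) : ℂ) • E2 + (((-1 : ℝ) : ℂ) • (E2 ∣[(2 : ℤ)] matR 2) +
    ((1 / 3 : ℝ) : ℂ) • (E2 ∣[(2 : ℤ)] matR 4))

lemma F_eq (z : ℍ) : F z = wpt (1 / 2) (2 * (z : ℂ)) := by
  rw [wpt_eq_E2]
  simp only [F, Pi.add_apply, Pi.smul_apply, smul_eq_mul, slash_matR]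
  push_cast
  ring

lemma F_slash (γ : SL(2, ℤ)) (h : (4 : ℤ) ∣ γ 1 0) : F ∣[(2 : ℤ)] γ = F := by
  have h2 : ((2 : ℕ) : ℤ) ∣ γ 1 0 := dvd_trans (by norm_num) h
  have h4 : ((4 : ℕ) : ℤ) ∣ γ 1 0 := by exact_mod_cast h
  simp only [F, SlashAction.add_slash, ModularForm.SL_smul_slash]
  rw [E2_matR_slash 2 γ h2, E2_matR_slash 4 γ h4, E2_slash_action]
  ext z
  simp only [Pi.add_apply, Pi.smul_apply, Pi.sub_apply, smul_eq_mul]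
  push_cast
  ring

/-- The modular form. -/
noncomputable def form : ModularForm (CongruenceSubgroup.Gamma0 4) 2 where
  toFun := F
  slash_action_eq' := by
    rintro _ ⟨γ, hγ, rfl⟩
    have h := F_slash γ (by
      have := CongruenceSubgroup.Gamma0_mem.mp hγ
      exact (ZMod.intCast_zmod_eq_zero_iff_dvd _ 4).mp this)
    rwa [ModularForm.SL_slash] at h
  holo' := by
    have h1 := E2_mdifferentiable
    exact (h1.const_smul _).add (((h1.slash 2 _).const_smul _).add ((h1.slash 2 _).const_smul _))
  bdd_at_cusps' := by
    intro c hc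
    have hc' : IsCusp c 𝒮ℒ := (Subgroup.IsArithmetic.isCusp_iff_isCusp_SL2Z _).mp hc
    exact (smul_bdd _ (E2_bdd_cusp hc')).add
      ((smul_bdd _ (E2_matR_bdd_cusp 2 hc')).add (smul_bdd _ (E2_matR_bdd_cusp 4 hc')))

/-- The matrix `(1 0; 4 1)`. -/
def gam : SL(2, ℤ) := ⟨!![1, 0; 4, 1], by simp [Matrix.det_fin_two_of]⟩

lemma first (τ : ℂ) (h : 0 < τ.im) :
    wpt (1 / 2) (2 * τ / (4 * τ + 1)) = (4 * τ + 1) ^ 2 * wpt (1 / 2) (2 * τ) := by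
  let z : ℍ := ⟨τ, h⟩
  have hz : (z : ℂ) = τ := rfl
  have hs := congrFun (F_slash gam (by simp [gam])) z
  have hd : denom gam z = 4 * τ + 1 := by
    rw [ModularGroup.denom_apply, hz]
    simp [gam]
  have hd0 : 4 * τ + 1 ≠ 0 := hd ▸ denom_ne_zero _ z
  have hg : ((gam • z : ℍ) : ℂ) = τ / (4 * τ + 1) := by
    rw [UpperHalfPlane.specialLinearGroup_apply]
    simp [gam, hz]
  rw [ModularForm.SL_slash_apply, F_eq, F_eq, hd, hg, hz] at hs
  rw [← hs, ← mul_div_assoc]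
  rw [zpow_neg, zpow_ofNat]
  rw [mul_left_comm, mul_inv_cancel₀ (pow_ne_zero 2 hd0), mul_one]

end WptAux

open UpperHalfPlane in
/-- `℘̃a(1/2, 2τ/(4τ+1)) = (4τ+1)² ℘̃a(1/2, 2τ)`; consequently
`τ ↦ ℘̃a(1/2, 2τ)` is a modular form of weight 2 for `Γ₀(4)`. -/
theorem wpt_half_gamma0_four :
    (∀ τ : ℂ, 0 < τ.im →
        wpt (1 / 2) (2 * τ / (4 * τ + 1)) = (4 * τ + 1) ^ 2 * wpt (1 / 2) (2 * τ)) ∧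
      ∃ f : ModularForm (CongruenceSubgroup.Gamma0 4) 2,
        ∀ τ : UpperHalfPlane, f τ = wpt (1 / 2) (2 * (τ : ℂ)) := by
  exact ⟨WptAux.first, WptAux.form, WptAux.F_eq⟩
end

section
/- For every τ in the upper half-plane H, ℘̃a(τ/(4τ+1), 2τ/(4τ+1)) = (4τ+1)² · ℘̃a(τ, 2τ); consequently the function τ ↦ ℘̃a(τ, 2τ) is a modular form of weight 2 for Γ₀(4). -/
open Complex

section WptAux

open UpperHalfPlane

theorem hasSum_of_eq_s7 {f g : ℤ × ℤ → ℂ} {x : ℂ} (h : ∀ p, f p = g p) (hg : HasSum g x) :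
    HasSum f x := by
  rw [funext h]; exact hg

/-- The period pair `(1, τ)`. -/
noncomputable def perPair (τ : UpperHalfPlane) : PeriodPair where
  ω₁ := 1
  ω₂ := τ
  indep := by
    rw [LinearIndependent.pair_iff]
    intro s t h
    have h1 := congrArg Complex.im h
    have h2 := congrArg Complex.re h
    simp at h1 h2
    have ht : t = 0 := by
      rcases h1 with h1 | h1
      · exact h1
      · exact absurd h1 τ.im_ne_zero
    subst ht
    simpa using h2

/-- Division values of order four of the Weierstrass function. -/
noncomputable def divVal (a b : ℤ) (τ : UpperHalfPlane) : ℂ :=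
  (perPair τ).weierstrassP (((a : ℂ) + b * τ) / 4)

theorem mem_perPair {τ : UpperHalfPlane} {x : ℂ} :
    x ∈ (perPair τ).lattice ↔ ∃ m n : ℤ, (m : ℂ) + n * τ = x := by
  rw [PeriodPair.mem_lattice]
  simp [perPair]

theorem weierstrassP_scale (L M : PeriodPair) (c : ℂ) (hc : c ≠ 0)
    (h1 : ∀ x ∈ M.lattice, c * x ∈ L.lattice) (h2 : ∀ x ∈ L.lattice, c⁻¹ * x ∈ M.lattice) (z : ℂ) :
    M.weierstrassP z = c ^ 2 * L.weierstrassP (c * z) := by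
  let e : M.lattice ≃ L.lattice :=
    { toFun := fun x => ⟨c * x, h1 x x.2⟩
      invFun := fun x => ⟨c⁻¹ * x, h2 x x.2⟩
      left_inv := fun x => by ext; simp [hc]
      right_inv := fun x => by ext; simp [hc] }
  rw [PeriodPair.weierstrassP, PeriodPair.weierstrassP, ← e.tsum_eq, ← tsum_mul_left]
  refine tsum_congr fun l => ?_
  have : ((e l : L.lattice) : ℂ) = c * l := rfl
  rw [this, ← mul_sub, mul_pow, mul_pow, mul_sub]
  congr 1
  · rw [mul_one_div, div_mul_eq_div_div, div_self (pow_ne_zero _ hc)]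
  · rw [mul_one_div, div_mul_eq_div_div, div_self (pow_ne_zero _ hc)]

theorem divVal_shift (a b k l : ℤ) (τ : UpperHalfPlane) :
    divVal (a + 4 * k) (b + 4 * l) τ = divVal a b τ := by
  have hm : (k : ℂ) + l * τ ∈ (perPair τ).lattice := mem_perPair.2 ⟨k, l, rfl⟩
  have := (perPair τ).weierstrassP_add_coe (((a : ℂ) + b * τ) / 4) ⟨_, hm⟩
  rw [divVal, divVal, ← this]
  congr 1
  push_cast
  ring

theorem divVal_neg (a b : ℤ) (τ : UpperHalfPlane) : divVal (-a) (-b) τ = divVal a b τ := by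
  rw [divVal, divVal, ← PeriodPair.weierstrassP_neg]
  congr 1
  push_cast
  ring

theorem divVal_smul (a b : ℤ) (g : Matrix.SpecialLinearGroup (Fin 2) ℤ) (τ : UpperHalfPlane) :
    divVal a b (g • τ) = denom g τ ^ 2 *
      divVal (a * g 1 1 + b * g 0 1) (a * g 1 0 + b * g 0 0) τ := by
  have hd : denom g τ ≠ 0 := denom_ne_zero _ _
  have hden : denom g τ = (g 1 0 : ℂ) * τ + g 1 1 := by simp [denom]
  have hdet : g 0 0 * g 1 1 - g 0 1 * g 1 0 = 1 := by
    rw [← Matrix.det_fin_two]; exact g.2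
  have hdetC : (g 0 0 : ℂ) * g 1 1 - g 0 1 * g 1 0 = 1 := by exact_mod_cast hdet
  have hsm : ((g • τ : UpperHalfPlane) : ℂ) = ((g 0 0 : ℂ) * τ + g 0 1) / denom g τ := by
    rw [coe_specialLinearGroup_apply, hden]; simp
  rw [divVal, weierstrassP_scale (perPair τ) (perPair (g • τ)) (denom g τ) hd, divVal]
  · congr 2
    rw [hsm]
    field_simp
    rw [hden]
    push_cast
    ring
  · intro x hx
    obtain ⟨m, n, rfl⟩ := mem_perPair.1 hx
    refine mem_perPair.2 ⟨m * g 1 1 + n * g 0 1, m * g 1 0 + n * g 0 0, ?_⟩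
    rw [hsm]
    field_simp
    rw [hden]
    push_cast
    ring
  · intro x hx
    obtain ⟨m, n, rfl⟩ := mem_perPair.1 hx
    refine mem_perPair.2 ⟨m * g 0 0 - n * g 0 1, n * g 1 1 - m * g 1 0, ?_⟩
    rw [hsm]
    field_simp
    rw [hden]
    push_cast
    linear_combination ((m : ℂ) + n * τ) * hdetC

theorem divVal_vadd (a b k : ℤ) (τ : UpperHalfPlane) :
    divVal a b (((4 * k : ℤ) : ℝ) +ᵥ τ) = divVal a b τ := by
  have hco : (((((4 * k : ℤ) : ℝ) +ᵥ τ : UpperHalfPlane)) : ℂ) = 4 * k + τ := by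
    simp
  rw [divVal, weierstrassP_scale (perPair τ) _ 1 one_ne_zero]
  · rw [← divVal_shift a b (b * k) 0, divVal, hco, one_pow, one_mul, one_mul]
    congr 1
    push_cast
    ring
  · intro x hx
    obtain ⟨m, n, rfl⟩ := mem_perPair.1 hx
    refine mem_perPair.2 ⟨m + 4 * n * k, n, ?_⟩
    rw [hco]
    push_cast
    ring
  · intro x hx
    obtain ⟨m, n, rfl⟩ := mem_perPair.1 hx
    refine mem_perPair.2 ⟨m - 4 * n * k, n, ?_⟩
    rw [hco]
    push_cast
    ring

/-- The summand of the series for `divVal`. -/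
noncomputable def divTerm (a b : ℤ) (p : ℤ × ℤ) (z : ℂ) : ℂ :=
  1 / (((a : ℂ) + b * z) / 4 + ((p.1 : ℂ) + p.2 * z)) ^ 2 - 1 / ((p.1 : ℂ) + p.2 * z) ^ 2

theorem hasSum_divVal (a b : ℤ) (τ : UpperHalfPlane) :
    HasSum (fun p => divTerm a b p τ) (divVal a b τ) := by
  have h := (perPair τ).hasSum_weierstrassP (((a : ℂ) + b * τ) / 4)
  rw [← (Equiv.neg _).hasSum_iff, ← (perPair τ).latticeEquivProd.symm.toEquiv.hasSum_iff] at h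
  refine hasSum_of_eq_s7 (fun p => ?_) h
  have := (perPair τ).latticeEquiv_symm_apply p
  simp only [Function.comp, divTerm, LinearEquiv.coe_toEquiv, Equiv.neg_apply,
    NegMemClass.coe_neg, this]
  simp only [perPair, mul_one, sub_neg_eq_add, neg_sq]

theorem hasSum_parity {f : ℤ × ℤ → ℂ} {x y : ℂ} (hx : HasSum (fun p : ℤ × ℤ => f (2 * p.1, p.2)) x)
    (hy : HasSum (fun p : ℤ × ℤ => f (2 * p.1 + 1, p.2)) y) : HasSum f (x + y) := by
  have i1 : Function.Injective (fun p : ℤ × ℤ => (2 * p.1, p.2)) := by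
    rintro ⟨a, b⟩ ⟨c, d⟩ h
    simp at h ⊢
    omega
  have i2 : Function.Injective (fun p : ℤ × ℤ => (2 * p.1 + 1, p.2)) := by
    rintro ⟨a, b⟩ ⟨c, d⟩ h
    simp at h ⊢
    omega
  refine HasSum.add_isCompl (s := Set.range (fun p : ℤ × ℤ => (2 * p.1, p.2)))
    (t := Set.range (fun p : ℤ × ℤ => (2 * p.1 + 1, p.2))) ?_ ?_ ?_
  · rw [← compl_eq_iff_isCompl]
    ext ⟨a, b⟩
    simp only [Set.mem_compl_iff, Set.mem_range, Prod.mk.injEq, Prod.exists, not_exists]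
    constructor
    · intro h
      have := h (a / 2) b
      exact ⟨a / 2, b, by omega, rfl⟩
    · rintro ⟨c, d, h1, h2⟩ e f'
      omega
  · exact (i1.hasSum_range_iff (f := f)).2 hx
  · exact (i2.hasSum_range_iff (f := f)).2 hy

theorem wpt_eq_s7 (τ : UpperHalfPlane) :
    wpt (τ : ℂ) (2 * (τ : ℂ)) =
      (Real.pi : ℂ)⁻¹ ^ 2 * (1 / 2 * (divVal 1 0 τ - divVal 1 2 τ)) := by
  rw [wpt]
  congr 1
  have e1 := ((hasSum_divVal 1 4 τ).sub (hasSum_divVal 1 2 τ)).mul_left (1 / 4)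
  have e2 := ((hasSum_divVal 3 4 τ).sub (hasSum_divVal 3 2 τ)).mul_left (1 / 4)
  have key : ∀ x y A B D : ℂ, A = 2 * x → B = 2 * y →
      1 / A ^ 2 - 1 / B ^ 2 = 1 / 4 * ((1 / x ^ 2 - D) - (1 / y ^ 2 - D)) := by
    rintro x y _ _ D rfl rfl
    simp only [mul_pow, one_div, mul_inv]
    ring
  have hs := hasSum_parity (f := fun p : ℤ × ℤ =>
      (1 / ((τ : ℂ) + ((p.1 : ℂ) + 1 / 2) + ((p.2 : ℂ) + 1 / 2) * (2 * (τ : ℂ))) ^ 2 -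
        1 / (((p.1 : ℂ) + 1 / 2) + ((p.2 : ℂ) + 1 / 2) * (2 * (τ : ℂ))) ^ 2))
    (x := 1 / 4 * (divVal 1 4 τ - divVal 1 2 τ)) (y := 1 / 4 * (divVal 3 4 τ - divVal 3 2 τ))
    (by
      refine hasSum_of_eq_s7 (fun p => ?_) e1
      refine key _ _ _ _ _ ?_ ?_ <;> push_cast <;> ring)
    (by
      refine hasSum_of_eq_s7 (fun p => ?_) e2
      refine key _ _ _ _ _ ?_ ?_ <;> push_cast <;> ring)
  rw [hs.tsum_eq]
  have a1 : divVal 1 4 τ = divVal 1 0 τ := by simpa using divVal_shift 1 0 0 1 τ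
  have a2 : divVal 3 4 τ = divVal 1 0 τ := by
    rw [← divVal_neg 1 0]; simpa using divVal_shift (-1) 0 1 1 τ
  have a3 : divVal 3 2 τ = divVal 1 2 τ := by
    rw [← divVal_neg 1 2]; simpa using divVal_shift (-1) (-2) 1 1 τ
  rw [a1, a2, a3]
  ring

/-- The one-variable majorant. -/
noncomputable def majOne (n : ℤ) : ℝ := (max 1 |(n : ℝ)|) ^ (-(3 / 2) : ℝ)

theorem summable_majOne : Summable majOne := by
  have h := Real.summable_abs_int_rpow (b := 3 / 2) (by norm_num)
  refine (summable_congr_cofinite ?_).2 h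
  have : ∀ᶠ n : ℤ in Filter.cofinite, n ≠ 0 := by
    simpa using (Set.finite_singleton (0 : ℤ)).eventually_cofinite_notMem
  filter_upwards [this] with n hn
  have : (1 : ℝ) ≤ |(n : ℝ)| := by exact_mod_cast Int.one_le_abs hn
  rw [majOne, max_eq_right this]

theorem majOne_nonneg (n : ℤ) : 0 ≤ majOne n := by
  unfold majOne; positivity

theorem summable_majTwo : Summable fun p : ℤ × ℤ => majOne p.1 * majOne p.2 :=
  summable_majOne.mul_of_nonneg summable_majOne majOne_nonneg majOne_nonneg

theorem le_majTwo (n m : ℤ) :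
    1 / (max 1 |(m : ℝ)| * max (max 1 |(n : ℝ)|) (max 1 |(m : ℝ)|) ^ 2) ≤ majOne n * majOne m := by
  unfold majOne
  set M := max 1 |(m : ℝ)| with hM
  set N := max 1 |(n : ℝ)| with hN
  have hM1 : 1 ≤ M := le_max_left _ _
  have hN1 : 1 ≤ N := le_max_left _ _
  have hM0 : 0 < M := by linarith
  have hN0 : 0 < N := by linarith
  set S := max N M
  have h1 : N ≤ S := le_max_left _ _
  have h2 : M ≤ S := le_max_right _ _
  have hS0 : 0 < S := by linarith
  rw [← Real.mul_rpow hN0.le hM0.le, Real.rpow_neg (by positivity), ← one_div]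
  refine one_div_le_one_div_of_le (by positivity) ?_
  have e : ((N * M) ^ (3 / 2 : ℝ)) ^ 2 = (N * M) ^ 3 := by
    rw [← Real.rpow_natCast, ← Real.rpow_mul (by positivity), ← Real.rpow_natCast]
    norm_num
  refine le_of_sq_le_sq ?_ (by positivity)
  rw [e]
  calc (N * M) ^ 3 = M ^ 2 * (N ^ 3 * M) := by ring
    _ ≤ M ^ 2 * (S ^ 3 * S) := by gcongr
    _ = (M * S ^ 2) ^ 2 := by ring

theorem half_le (n a : ℤ) (ha : |a| ≤ 2) : |(n : ℝ)| / 2 ≤ |(a : ℝ) / 4 + n| := by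
  have h : 2 * |n| ≤ |a + 4 * n| := by
    rw [abs_le] at ha
    rcases abs_cases n with h | h <;> rcases abs_cases (a + 4 * n) with h' | h' <;> omega
  have h' : 2 * |(n : ℝ)| ≤ |(a : ℝ) + 4 * n| := by exact_mod_cast h
  have : (a : ℝ) / 4 + n = (a + 4 * n) / 4 := by ring
  rw [this, abs_div, abs_of_pos (by norm_num : (0 : ℝ) < 4)]
  linarith

/-- Lower bounds for a real linear form on a vertical strip. -/
theorem strip_lower (A B : ℝ) (hA : 0 ≤ A) (hB : 0 < B) :
    ∃ r : ℝ, 0 < r ∧ ∀ z : ℂ, |z.re| ≤ A → B ≤ z.im → ∀ x y : ℝ,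
      r * max |x| |y| ≤ ‖(x : ℂ) + y * z‖ ∧ |y| * z.im ≤ ‖(x : ℂ) + y * z‖ := by
  refine ⟨B / (1 + A + B), by positivity, fun z h1 h2 x y => ?_⟩
  have him : |y| * z.im ≤ ‖(x : ℂ) + y * z‖ := by
    have := Complex.abs_im_le_norm ((x : ℂ) + y * z)
    simp only [add_im, ofReal_im, zero_add, mul_im, ofReal_re, zero_mul, add_zero] at this
    rwa [abs_mul, abs_of_pos (lt_of_lt_of_le hB h2)] at this
  have hre : |x + y * z.re| ≤ ‖(x : ℂ) + y * z‖ := by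
    have := Complex.abs_re_le_norm ((x : ℂ) + y * z)
    simpa using this
  refine ⟨?_, him⟩
  set W := ‖(x : ℂ) + y * z‖
  have hW : 0 ≤ W := norm_nonneg _
  have hy : |y| * B ≤ W := le_trans (by gcongr) him
  have hx : |x| ≤ W + |y| * A := by
    have : |x| ≤ |x + y * z.re| + |y * z.re| := by
      have := abs_sub (x + y * z.re) (y * z.re)
      simpa using this
    rw [abs_mul] at this
    have h3 : |y| * |z.re| ≤ |y| * A := by gcongr
    linarith
  rw [div_mul_eq_mul_div, div_le_iff₀ (by positivity)]
  rcases max_cases |x| |y| with ⟨h, -⟩ | ⟨h, -⟩ <;> rw [h]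
  · have : |x| * B ≤ W * B + A * W := by
      calc |x| * B ≤ (W + |y| * A) * B := by gcongr
        _ = W * B + A * (|y| * B) := by ring
        _ ≤ W * B + A * W := by gcongr
    nlinarith
  · nlinarith [mul_nonneg hW hA, mul_nonneg hW hB.le]

theorem divTerm_bound (a b : ℤ) (ha : |a| ≤ 2) (hb : |b| ≤ 2) (hab : ¬ (a = 0 ∧ b = 0))
    (A B : ℝ) (hA : 0 ≤ A) (hB : 0 < B) :
    ∃ C : ℝ, ∀ z : ℂ, |z.re| ≤ A → B ≤ z.im → ∀ p : ℤ × ℤ,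
      ‖divTerm a b p z‖ ≤ C * (majOne p.1 * majOne p.2) := by
  obtain ⟨r, hr, hlow⟩ := strip_lower A B hA hB
  set K : ℝ := (1 + A + B) / B with hK
  have hK0 : 0 < K := by positivity
  refine ⟨(16 + 6 * K) / r ^ 2, fun z h1 h2 p => ?_⟩
  obtain ⟨n, m⟩ := p
  have ht : 0 < z.im := lt_of_lt_of_le hB h2
  refine le_trans ?_ (mul_le_mul_of_nonneg_left (le_majTwo n m) (by positivity))
  set α : ℂ := ((a : ℂ) + b * z) / 4 + ((n : ℂ) + m * z) with hα
  set ω : ℂ := (n : ℂ) + m * z with hω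
  have hT : divTerm a b (n, m) z = 1 / α ^ 2 - 1 / ω ^ 2 := rfl
  have hα' : α = (((a : ℝ) / 4 + n : ℝ) : ℂ) + (((b : ℝ) / 4 + m : ℝ) : ℂ) * z := by
    rw [hα]; push_cast; ring
  have hω' : ω = ((n : ℝ) : ℂ) + ((m : ℝ) : ℂ) * z := by
    rw [hω]; push_cast; ring
  have lα := hlow z h1 h2 ((a : ℝ) / 4 + n) ((b : ℝ) / 4 + m)
  have lω := hlow z h1 h2 n m
  rw [← hα'] at lα
  rw [← hω'] at lω
  rw [hT]
  by_cases hp : n = 0 ∧ m = 0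
  · obtain ⟨rfl, rfl⟩ := hp
    have hω0 : ω = 0 := by simp [hω]
    have h4 : 1 / 4 ≤ max |(a : ℝ) / 4 + (0 : ℤ)| |(b : ℝ) / 4 + (0 : ℤ)| := by
      have aux : ∀ c : ℤ, c ≠ 0 → 1 / 4 ≤ |(c : ℝ) / 4 + (0 : ℤ)| := by
        intro c hc
        have : (1 : ℝ) ≤ |(c : ℝ)| := by exact_mod_cast Int.one_le_abs hc
        rw [Int.cast_zero, add_zero, abs_div, abs_of_pos (by norm_num : (0 : ℝ) < 4)]
        linarith
      by_cases ha0 : a = 0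
      · exact le_trans (aux b fun hb0 => hab ⟨ha0, hb0⟩) (le_max_right _ _)
      · exact le_trans (aux a ha0) (le_max_left _ _)
    have h5 : r * (1 / 4) ≤ ‖α‖ := le_trans (by gcongr) lα.1
    have : ‖1 / α ^ 2 - 1 / ω ^ 2‖ ≤ 16 / r ^ 2 := by
      rw [hω0]
      simp only [ne_eq, OfNat.ofNat_ne_zero, not_false_eq_true, zero_pow, div_zero, sub_zero,
        norm_div, norm_one, norm_pow]
      calc 1 / ‖α‖ ^ 2 ≤ 1 / (r * (1 / 4)) ^ 2 := by gcongr
        _ = 16 / r ^ 2 := by field_simp; norm_num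
    refine this.trans ?_
    simp only [Int.cast_zero, abs_zero, zero_le_one, sup_of_le_left, max_self, one_pow, mul_one,
      ne_eq, one_ne_zero, not_false_eq_true, div_self]
    gcongr
    linarith
  · have hS : max (max 1 |(n : ℝ)|) (max 1 |(m : ℝ)|) = max |(n : ℝ)| |(m : ℝ)| := by
      have : 1 ≤ max |(n : ℝ)| |(m : ℝ)| := by
        by_cases hn : n = 0
        · refine le_max_of_le_right ?_
          exact_mod_cast Int.one_le_abs fun hm => hp ⟨hn, hm⟩
        · refine le_max_of_le_left ?_
          exact_mod_cast Int.one_le_abs hn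
      rw [max_max_max_comm, max_self, max_eq_right this]
    have hS1 : 1 ≤ max (max 1 |(n : ℝ)|) (max 1 |(m : ℝ)|) :=
      le_max_of_le_left (le_max_left _ _)
    rw [hS] at hS1 ⊢
    set S := max |(n : ℝ)| |(m : ℝ)| with hSdef
    have hS0 : 0 < S := by linarith
    have hSα : r * (S / 2) ≤ ‖α‖ := by
      refine le_trans ?_ lα.1
      gcongr
      rw [hSdef]
      rcases max_cases |(n : ℝ)| |(m : ℝ)| with ⟨h, -⟩ | ⟨h, -⟩ <;> rw [h]
      · exact le_max_of_le_left (half_le n a ha)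
      · exact le_max_of_le_right (half_le m b hb)
    have hSω : r * S ≤ ‖ω‖ := lω.1
    have hα0 : 0 < ‖α‖ := lt_of_lt_of_le (by positivity) hSα
    have hω0 : 0 < ‖ω‖ := lt_of_lt_of_le (by positivity) hSω
    by_cases hm : m = 0
    · have hM : max 1 |(m : ℝ)| = 1 := by simp [hm]
      rw [hM, one_mul]
      calc ‖1 / α ^ 2 - 1 / ω ^ 2‖ ≤ ‖1 / α ^ 2‖ + ‖1 / ω ^ 2‖ := norm_sub_le _ _
        _ = 1 / ‖α‖ ^ 2 + 1 / ‖ω‖ ^ 2 := by simp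
        _ ≤ 1 / (r * (S / 2)) ^ 2 + 1 / (r * S) ^ 2 := by gcongr
        _ = 5 / r ^ 2 * (1 / S ^ 2) := by field_simp; norm_num
        _ ≤ (16 + 6 * K) / r ^ 2 * (1 / S ^ 2) := by gcongr; linarith
    · have hm1 : (1 : ℝ) ≤ |(m : ℝ)| := by exact_mod_cast Int.one_le_abs hm
      rw [max_eq_right hm1]
      set μ := |(m : ℝ)|
      have hμ0 : 0 < μ := by linarith
      have hmα : μ * z.im / 2 ≤ ‖α‖ := by
        refine le_trans ?_ lα.2
        rw [mul_div_right_comm]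
        gcongr
        exact half_le m b hb
      have hmω : μ * z.im ≤ ‖ω‖ := lω.2
      have hdiff : ‖ω - α‖ ≤ K * z.im := by
        have e : ω - α = -(((a : ℂ) + b * z) / 4) := by rw [hα]; ring
        have ha' : ‖(a : ℂ)‖ ≤ 2 := by
          rw [Complex.norm_intCast]; exact_mod_cast ha
        have hb' : ‖(b : ℂ)‖ ≤ 2 := by
          rw [Complex.norm_intCast]; exact_mod_cast hb
        have hz : ‖z‖ ≤ A + z.im := by
          have := Complex.norm_le_abs_re_add_abs_im z
          rw [abs_of_pos ht] at this
          linarith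
        have : ‖(a : ℂ) + b * z‖ ≤ 2 + 2 * (A + z.im) := by
          refine (norm_add_le _ _).trans ?_
          rw [norm_mul]
          gcongr
        rw [e, norm_neg, norm_div]
        have h4 : ‖(4 : ℂ)‖ = 4 := by simp
        rw [h4]
        have hKt : 1 + A + z.im ≤ K * z.im := by
          rw [hK, div_mul_eq_mul_div, le_div_iff₀ hB]
          nlinarith
        linarith
      have hαn : α ≠ 0 := norm_pos_iff.1 hα0
      have hωn : ω ≠ 0 := norm_pos_iff.1 hω0
      have e : 1 / α ^ 2 - 1 / ω ^ 2 = (ω - α) * (1 / (α ^ 2 * ω) + 1 / (α * ω ^ 2)) := by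
        field_simp
        ring
      calc ‖1 / α ^ 2 - 1 / ω ^ 2‖
          ≤ ‖ω - α‖ * (‖1 / (α ^ 2 * ω)‖ + ‖1 / (α * ω ^ 2)‖) := by
            rw [e, norm_mul]; gcongr; exact norm_add_le _ _
        _ = ‖ω - α‖ * (1 / (‖α‖ * ‖α‖ * ‖ω‖) + 1 / (‖α‖ * (‖ω‖ * ‖ω‖))) := by
            simp [pow_two]
        _ ≤ (K * z.im) * (1 / ((μ * z.im / 2) * (r * (S / 2)) * (r * S)) +
              1 / ((μ * z.im / 2) * ((r * S) * (r * S)))) := by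
            gcongr
        _ = 6 * K / r ^ 2 * (1 / (μ * S ^ 2)) := by field_simp; norm_num
        _ ≤ (16 + 6 * K) / r ^ 2 * (1 / (μ * S ^ 2)) := by gcongr; linarith

theorem divVal_zero : divVal 0 0 = 0 := by
  funext τ
  simp [divVal]

theorem exists_reduced (a b : ℤ) :
    ∃ a' b' : ℤ, |a'| ≤ 2 ∧ |b'| ≤ 2 ∧ divVal a b = divVal a' b' := by
  refine ⟨(a + 2) % 4 - 2, (b + 2) % 4 - 2, ?_, ?_, ?_⟩
  · rw [abs_le]; omega
  · rw [abs_le]; omega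
  · funext τ
    rw [← divVal_shift ((a + 2) % 4 - 2) _ ((a + 2) / 4) ((b + 2) / 4)]
    congr 1 <;> omega

theorem lin_ne_zero (a b : ℤ) (ha : |a| ≤ 2) (hb : |b| ≤ 2) (hab : ¬ (a = 0 ∧ b = 0))
    (p : ℤ × ℤ) (z : ℂ) (hz : 0 < z.im) :
    ((a : ℂ) + b * z) / 4 + ((p.1 : ℂ) + p.2 * z) ≠ 0 := by
  intro h
  have h' : ((a + 4 * p.1 : ℤ) : ℂ) + ((b + 4 * p.2 : ℤ) : ℂ) * z = 0 := by
    push_cast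
    linear_combination 4 * h
  have h1 := congrArg Complex.im h'
  have h2 := congrArg Complex.re h'
  simp only [add_im, intCast_im, mul_im, intCast_re, zero_mul, add_zero, zero_add, zero_im,
    mul_eq_zero, hz.ne', or_false] at h1
  have hb0 : b + 4 * p.2 = 0 := by exact_mod_cast h1
  rw [hb0] at h2
  simp only [Int.cast_zero, zero_mul, add_zero, intCast_re, zero_re] at h2
  have ha0 : a + 4 * p.1 = 0 := by exact_mod_cast h2
  rw [abs_le] at ha hb
  omega

theorem divTerm_diff (a b : ℤ) (ha : |a| ≤ 2) (hb : |b| ≤ 2) (hab : ¬ (a = 0 ∧ b = 0))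
    (p : ℤ × ℤ) (z : ℂ) (hz : 0 < z.im) : DifferentiableAt ℂ (divTerm a b p) z := by
  have h1 := lin_ne_zero a b ha hb hab p z hz
  have d1 : DifferentiableAt ℂ
      (fun z : ℂ => 1 / (((a : ℂ) + b * z) / 4 + ((p.1 : ℂ) + p.2 * z)) ^ 2) z :=
    DifferentiableAt.div (by fun_prop) (by fun_prop) (pow_ne_zero _ h1)
  have d2 : DifferentiableAt ℂ (fun z : ℂ => 1 / ((p.1 : ℂ) + p.2 * z) ^ 2) z := by
    by_cases hp : p.1 = 0 ∧ p.2 = 0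
    · simp [hp.1, hp.2]
    · refine DifferentiableAt.div (by fun_prop) (by fun_prop) (pow_ne_zero _ fun h => hp ?_)
      have h1 := congrArg Complex.im h
      have h2 := congrArg Complex.re h
      simp only [add_im, intCast_im, mul_im, intCast_re, zero_mul, add_zero, zero_add, zero_im,
        mul_eq_zero, hz.ne', or_false] at h1
      have hb0 : p.2 = 0 := by exact_mod_cast h1
      rw [hb0] at h2
      simp only [Int.cast_zero, zero_mul, add_zero, intCast_re, zero_re] at h2
      exact ⟨by exact_mod_cast h2, hb0⟩
  exact d1.sub d2

open scoped Manifold in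
theorem divVal_mdiff (a b : ℤ) : MDiff (divVal a b) := by
  obtain ⟨a', b', ha, hb, he⟩ := exists_reduced a b
  rw [he]
  by_cases hab : a' = 0 ∧ b' = 0
  · rw [hab.1, hab.2, divVal_zero]
    exact mdifferentiable_const
  rw [UpperHalfPlane.mdifferentiable_iff]
  have hd : DifferentiableOn ℂ (fun z => ∑' p, divTerm a' b' p z) {z | 0 < z.im} := by
    intro z hz
    have hz' : 0 < z.im := hz
    obtain ⟨C, hC⟩ := divTerm_bound a' b' ha hb hab (|z.re| + 1) (z.im / 2) (by positivity)
      (by positivity)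
    have hU : IsOpen {w : ℂ | |w.re| < |z.re| + 1 ∧ z.im / 2 < w.im} :=
      (isOpen_lt (f := fun w : ℂ => |w.re|) (g := fun _ => |z.re| + 1)
        Complex.continuous_re.abs continuous_const).inter
      (isOpen_lt (f := fun _ : ℂ => z.im / 2) (g := fun w : ℂ => w.im)
        continuous_const Complex.continuous_im)
    have := differentiableOn_tsum_of_summable_norm (summable_majTwo.mul_left C)
      (F := fun p z => divTerm a' b' p z)
      (fun p w hw => (divTerm_diff a' b' ha hb hab p w
        (lt_trans (by positivity) hw.2)).differentiableWithinAt) hU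
      (fun p w hw => hC w hw.1.le hw.2.le p)
    exact (this.differentiableAt (hU.mem_nhds ⟨by linarith, by linarith⟩)).differentiableWithinAt
  refine hd.congr fun z hz => ?_
  rw [Function.comp, ofComplex_apply_of_im_pos hz]
  exact (hasSum_divVal a' b' ⟨z, hz⟩).tsum_eq.symm

theorem divVal_bdd (a b : ℤ) : IsBoundedAtImInfty (divVal a b) := by
  obtain ⟨a', b', ha, hb, he⟩ := exists_reduced a b
  rw [he, isBoundedAtImInfty_iff]
  by_cases hab : a' = 0 ∧ b' = 0
  · rw [hab.1, hab.2, divVal_zero]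
    exact ⟨0, 0, by simp⟩
  obtain ⟨C, hC⟩ := divTerm_bound a' b' ha hb hab 4 1 (by norm_num) (by norm_num)
  have hs := summable_majTwo.mul_left C
  refine ⟨∑' p : ℤ × ℤ, C * (majOne p.1 * majOne p.2), 1, fun τ hτ => ?_⟩
  · rw [← divVal_vadd a' b' (-⌊τ.re / 4⌋) τ, ← (hasSum_divVal a' b' _).tsum_eq]
    refine tsum_of_norm_bounded hs.hasSum fun p => hC _ ?_ ?_ p
    · have h1 := Int.floor_le (τ.re / 4)
      have h2 := Int.lt_floor_add_one (τ.re / 4)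
      rw [coe_re, vadd_re]
      push_cast
      rw [abs_le]
      constructor <;> linarith
    · rw [coe_im, vadd_im]
      exact hτ

/-- The function of the theorem. -/
noncomputable def wptForm (τ : UpperHalfPlane) : ℂ :=
  (Real.pi : ℂ)⁻¹ ^ 2 * (1 / 2 * (divVal 1 0 τ - divVal 1 2 τ))

open scoped ModularForm

theorem wptForm_slash (g : Matrix.SpecialLinearGroup (Fin 2) ℤ) :
    wptForm ∣[(2 : ℤ)] g = fun τ => (Real.pi : ℂ)⁻¹ ^ 2 * (1 / 2 *
      (divVal (g 1 1) (g 1 0) τ - divVal (g 1 1 + 2 * g 0 1) (g 1 0 + 2 * g 0 0) τ)) := by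
  funext τ
  rw [ModularForm.SL_slash_apply, wptForm, divVal_smul, divVal_smul]
  have hd : denom g τ ≠ 0 := denom_ne_zero _ _
  simp only [one_mul, zero_mul, add_zero]
  rw [zpow_neg, zpow_ofNat]
  field_simp

theorem wptForm_invariant (g : Matrix.SpecialLinearGroup (Fin 2) ℤ)
    (hg : g ∈ CongruenceSubgroup.Gamma0 4) : wptForm ∣[(2 : ℤ)] g = wptForm := by
  rw [wptForm_slash]
  funext τ
  rw [wptForm]
  rw [CongruenceSubgroup.Gamma0_mem, ZMod.intCast_zmod_eq_zero_iff_dvd] at hg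
  obtain ⟨c, hc⟩ := hg
  push_cast at hc
  have hdet : g 0 0 * g 1 1 - g 0 1 * g 1 0 = 1 := by
    rw [← Matrix.det_fin_two]; exact g.2
  have hodd : Odd (g 0 0 * g 1 1) := ⟨2 * (g 0 1 * c), by rw [hc] at hdet; linarith⟩
  obtain ⟨⟨a, ha⟩, ⟨d, hd⟩⟩ := Int.odd_mul.1 hodd
  have key : ∀ x y : ℤ, (∃ k l, (x = 1 + 4 * k ∧ y = 0 + 4 * l) ∨ (x = -1 + 4 * k ∧ y = -0 + 4 * l)) →
      divVal x y τ = divVal 1 0 τ := by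
    rintro x y ⟨k, l, ⟨rfl, rfl⟩ | ⟨rfl, rfl⟩⟩
    · exact divVal_shift _ _ _ _ _
    · rw [divVal_shift, divVal_neg]
  have key2 : ∀ x y : ℤ, (∃ k l, (x = 1 + 4 * k ∧ y = 2 + 4 * l) ∨ (x = -1 + 4 * k ∧ y = -2 + 4 * l)) →
      divVal x y τ = divVal 1 2 τ := by
    rintro x y ⟨k, l, ⟨rfl, rfl⟩ | ⟨rfl, rfl⟩⟩
    · exact divVal_shift _ _ _ _ _
    · rw [divVal_shift, divVal_neg]
  have k1 := key (g 1 1) (g 1 0) (by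
    rcases Int.even_or_odd' d with ⟨k, hk | hk⟩
    · exact ⟨k, c, Or.inl (by omega)⟩
    · exact ⟨k + 1, c, Or.inr (by omega)⟩)
  have k2 := key2 (g 1 1 + 2 * g 0 1) (g 1 0 + 2 * g 0 0) (by
    rcases Int.even_or_odd' (d + g 0 1) with ⟨k, hk | hk⟩
    · exact ⟨k, c + a, Or.inl (by omega)⟩
    · exact ⟨k + 1, c + a + 1, Or.inr (by omega)⟩)
  rw [k1, k2]

open scoped Manifold in
theorem wptForm_mdiff : MDiff wptForm := by
  have h := (divVal_mdiff 1 0).sub (divVal_mdiff 1 2)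
  have h2 := h.const_smul ((Real.pi : ℂ)⁻¹ ^ 2 * (1 / 2))
  convert h2 using 1
  funext τ
  simp [wptForm]
  ring

theorem wptForm_bdd (g : Matrix.SpecialLinearGroup (Fin 2) ℤ) :
    IsBoundedAtImInfty (wptForm ∣[(2 : ℤ)] g) := by
  rw [wptForm_slash]
  have h := (divVal_bdd (g 1 1) (g 1 0)).sub (divVal_bdd (g 1 1 + 2 * g 0 1) (g 1 0 + 2 * g 0 0))
  have h2 := (h.const_mul_left (1 / 2)).const_mul_left ((Real.pi : ℂ)⁻¹ ^ 2)
  exact h2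

/-- The modular form of the theorem. -/
noncomputable def wptModular : ModularForm (CongruenceSubgroup.Gamma0 4) 2 where
  toFun := wptForm
  slash_action_eq' := by
    rintro _ ⟨g, hg, rfl⟩
    exact wptForm_invariant g hg
  holo' := wptForm_mdiff
  bdd_at_cusps' := by
    intro c hc
    rw [Subgroup.IsArithmetic.isCusp_iff_isCusp_SL2Z] at hc
    rw [OnePoint.isBoundedAt_iff_forall_SL2Z hc]
    exact fun g _ => wptForm_bdd g

end WptAux

open UpperHalfPlane in
/-- `℘̃a(τ/(4τ+1), 2τ/(4τ+1)) = (4τ+1)² ℘̃a(τ, 2τ)`; consequently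
`τ ↦ ℘̃a(τ, 2τ)` is a modular form of weight 2 for `Γ₀(4)`. -/
theorem wpt_tau_gamma0_four :
    (∀ τ : ℂ, 0 < τ.im →
        wpt (τ / (4 * τ + 1)) (2 * τ / (4 * τ + 1)) = (4 * τ + 1) ^ 2 * wpt τ (2 * τ)) ∧
      ∃ f : ModularForm (CongruenceSubgroup.Gamma0 4) 2,
        ∀ τ : UpperHalfPlane, f τ = wpt (τ : ℂ) (2 * (τ : ℂ)) := by
  refine ⟨fun τ hτ => ?_, wptModular, fun τ => (wpt_eq_s7 τ).symm⟩
  let g : Matrix.SpecialLinearGroup (Fin 2) ℤ := ⟨!![1, 0; 4, 1], by simp⟩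
  have hg : g ∈ CongruenceSubgroup.Gamma0 4 := by
    rw [CongruenceSubgroup.Gamma0_mem]
    change ((4 : ℤ) : ZMod 4) = 0
    decide
  have h := congrFun (wptForm_invariant g hg) ⟨τ, hτ⟩
  rw [ModularForm.slash_action_eq'_iff] at h
  have e1 := wpt_eq_s7 ⟨τ, hτ⟩
  have e2 := wpt_eq_s7 (g • ⟨τ, hτ⟩)
  rw [← wptForm] at e1 e2
  rw [← e1, ← e2, UpperHalfPlane.coe_specialLinearGroup_apply] at h
  simp [g] at h
  rw [← h, mul_div_assoc]
end

section
/- Let Φ(τ) = ℘a(1/2 + τ, 2τ) for τ in the upper half-plane H. Then for every τ ∈ H, Φ(τ/(4τ+1)) = (4τ+1)² · Φ(τ); consequently Φ is a modular form of weight 2 for Γ₀(4). -/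
open Complex

namespace PhiAux

/-- The period pair `(cτ+d, 2(aτ+b))`. -/
noncomputable def pp (a b c d : ℤ) (h : a * d - b * c = 1) (τ : ℂ) (hτ : 0 < τ.im) : PeriodPair where
  ω₁ := c * τ + d
  ω₂ := 2 * (a * τ + b)
  indep := by
    rw [LinearIndependent.pair_iff]
    intro s t hst
    have him := congrArg Complex.im hst
    have hre := congrArg Complex.re hst
    simp at him hre
    have hR : (a * d - b * c : ℝ) = 1 := by exact_mod_cast h
    have e1 : s * c + 2 * t * a = 0 := by
      have : (s * c + 2 * t * a) * τ.im = 0 := by linear_combination him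
      rcases mul_eq_zero.mp this with h | h
      · exact h
      · exact absurd h hτ.ne'
    have e2 : s * d + 2 * t * b = 0 := by linear_combination hre - τ.re * e1
    constructor
    · linear_combination -s * hR + a * e2 - b * e1
    · linear_combination -t * hR + d / 2 * e1 - c / 2 * e2

lemma wpa_eq (L : PeriodPair) (h1 : L.ω₁ ≠ 0) (z : ℂ) :
    wpa (z / L.ω₁) (L.ω₂ / L.ω₁) = L.ω₁ ^ 2 * ((Real.pi : ℂ)⁻¹ ^ 2 * L.weierstrassP z) := by
  have hP : Summable fun p : ℤ × ℤ => (1 / (z - (p.1 * L.ω₁ + p.2 * L.ω₂)) ^ 2 -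
      1 / (p.1 * L.ω₁ + p.2 * L.ω₂) ^ 2) := by
    have := (L.latticeEquivProd.symm.toEquiv.summable_iff).mpr (L.hasSum_weierstrassP z).summable
    refine this.congr fun p => ?_
    simp [L.latticeEquiv_symm_apply]
  have hW : L.weierstrassP z = ∑' p : ℤ × ℤ, (1 / (z - (p.1 * L.ω₁ + p.2 * L.ω₂)) ^ 2 -
      1 / (p.1 * L.ω₁ + p.2 * L.ω₂) ^ 2) := by
    rw [PeriodPair.weierstrassP, ← L.latticeEquivProd.symm.toEquiv.tsum_eq]
    refine tsum_congr fun p => ?_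
    simp [L.latticeEquiv_symm_apply]
  rw [hW, hP.tsum_eq_add_tsum_ite 0, wpa, mul_left_comm]
  congr 1
  rw [mul_add, ← tsum_mul_left]
  congr 1
  · simp [div_pow]
    rw [div_eq_mul_inv]
  · refine tsum_congr fun p => ?_
    split_ifs with hp
    · simp
    · have e1 : z / L.ω₁ - (p.1 + p.2 * (L.ω₂ / L.ω₁)) = (z - (p.1 * L.ω₁ + p.2 * L.ω₂)) / L.ω₁ := by
        field_simp
      have e2 : (p.1 + p.2 * (L.ω₂ / L.ω₁)) = (p.1 * L.ω₁ + p.2 * L.ω₂) / L.ω₁ := by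
        field_simp
      rw [e1, e2, div_pow, div_pow, mul_sub]
      simp [div_eq_mul_inv]

lemma weierstrassP_congr {L L' : PeriodPair} (h : L.lattice = L'.lattice) (z : ℂ) :
    L.weierstrassP z = L'.weierstrassP z := by
  simp only [PeriodPair.weierstrassP]
  rw [h]

lemma denom_ne {a b c d : ℤ} (h : a * d - b * c = 1) {τ : ℂ} (hτ : 0 < τ.im) :
    (c * τ + d : ℂ) ≠ 0 := by
  intro h0
  have := (pp a b c d h τ hτ).indep.ne_zero 0
  exact this h0

/-- The transformation of `Φ` under a matrix of determinant one. -/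
lemma wpa_moeb {a b c d : ℤ} (h : a * d - b * c = 1) {τ : ℂ} (hτ : 0 < τ.im) :
    wpa (1 / 2 + (a * τ + b) / (c * τ + d)) (2 * ((a * τ + b) / (c * τ + d))) =
      (c * τ + d) ^ 2 * ((Real.pi : ℂ)⁻¹ ^ 2 *
        (pp a b c d h τ hτ).weierstrassP ((c * τ + d) / 2 + (a * τ + b))) := by
  have h1 := denom_ne h hτ
  have := wpa_eq (pp a b c d h τ hτ) h1 ((c * τ + d) / 2 + (a * τ + b))
  simp only [pp] at this ⊢
  rw [← this]
  have e : ∀ X Y : ℂ, X ≠ 0 → 1 / 2 + Y / X = (X / 2 + Y) / X := by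
    intro X Y hX
    field_simp
  rw [e _ _ h1, mul_div_assoc]

lemma wpa_id {τ : ℂ} (hτ : 0 < τ.im) :
    wpa (1 / 2 + τ) (2 * τ) = ((Real.pi : ℂ)⁻¹ ^ 2 *
        (pp 1 0 0 1 (by norm_num) τ hτ).weierstrassP (1 / 2 + τ)) := by
  simpa using wpa_moeb (a := 1) (b := 0) (c := 0) (d := 1) (by norm_num) hτ

lemma lattice_eq {a b c d : ℤ} (h : a * d - b * c = 1) (hc : (4 : ℤ) ∣ c) {τ : ℂ} (hτ : 0 < τ.im) :
    (pp a b c d h τ hτ).lattice = (pp 1 0 0 1 (by norm_num) τ hτ).lattice := by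
  obtain ⟨e, rfl⟩ := hc
  have hC : (a * d - b * (4 * e) : ℂ) = 1 := by exact_mod_cast h
  ext x
  rw [PeriodPair.mem_lattice, PeriodPair.mem_lattice]
  simp only [pp]
  constructor
  · rintro ⟨m, n, rfl⟩
    exact ⟨m * d + 2 * n * b, m * 2 * e + n * a, by push_cast; ring⟩
  · rintro ⟨m, n, rfl⟩
    refine ⟨m * a - 2 * n * b, n * d - m * 2 * e, ?_⟩
    push_cast
    linear_combination (m + 2 * n * τ) * hC

lemma wpa_gamma0 {a b c d : ℤ} (h : a * d - b * c = 1) (hc : (4 : ℤ) ∣ c) {τ : ℂ} (hτ : 0 < τ.im) :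
    wpa (1 / 2 + (a * τ + b) / (c * τ + d)) (2 * ((a * τ + b) / (c * τ + d))) =
      (c * τ + d) ^ 2 * wpa (1 / 2 + τ) (2 * τ) := by
  rw [wpa_moeb h hτ, wpa_id hτ, weierstrassP_congr (lattice_eq h hc hτ)]
  congr 2
  obtain ⟨e, rfl⟩ := hc
  have hd : Odd (a * d) := ⟨2 * b * e, by linarith⟩
  obtain ⟨⟨u, hu⟩, ⟨v, hv⟩⟩ := Int.odd_mul.mp hd
  set L := pp 1 0 0 1 (by norm_num) τ hτ
  have hl : ((v + b : ℤ) : ℂ) * L.ω₁ + ((e + u : ℤ) : ℂ) * L.ω₂ ∈ L.lattice :=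
    PeriodPair.mem_lattice.mpr ⟨_, _, rfl⟩
  have := L.weierstrassP_add_coe (1 / 2 + τ) ⟨_, hl⟩
  rw [← this]
  congr 1
  simp only [L, pp]
  rw [hu, hv]
  push_cast
  ring

open EisensteinSeries in
/-- Uniform bound for the lattice sums of `pp a b c d`. -/
lemma G_bound (k : ℕ) (hk : 3 ≤ k) : ∃ B : ℝ, ∀ (a b c d : ℤ) (h : a * d - b * c = 1)
    (τ : UpperHalfPlane), 2 ≤ τ.im → ‖(pp a b c d h τ τ.2).G k‖ ≤ B := by
  have hk' : (2 : ℝ) < k := by exact_mod_cast hk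
  refine ⟨∑' x : Fin 2 → ℤ, r ⟨⟨1, 2⟩, Nat.ofNat_pos⟩ ^ (-(k : ℝ)) * ‖x‖ ^ (-(k : ℝ)), ?_⟩
  intro a b c d h τ hτ
  have hS := (summable_one_div_norm_rpow hk').mul_left (r ⟨⟨1, 2⟩, Nat.ofNat_pos⟩ ^ (-(k : ℝ)))
  set L := pp a b c d h τ τ.2 with hL
  obtain ⟨n, hn⟩ := UpperHalfPlane.ModularGroup_T_zpow_mem_verticalStrip τ (N := 1) one_pos
  have hn' := UpperHalfPlane.verticalStrip_anti_right _ hτ hn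
  set τ' := ModularGroup.T ^ ((1 : ℕ) * n : ℤ) • τ with hτ'
  have hc : (τ' : ℂ) = τ + n := by
    rw [hτ', UpperHalfPlane.modular_T_zpow_smul]
    simp [add_comm]
  let φ : ℤ × ℤ → (Fin 2 → ℤ) := fun p => ![p.1 * c + 2 * p.2 * a,
    p.1 * d + 2 * p.2 * b - n * (p.1 * c + 2 * p.2 * a)]
  have hφ : Function.Injective φ := by
    rintro ⟨p, q⟩ ⟨p', q'⟩ hpq
    have h0 := congrFun hpq 0
    have h1 := congrFun hpq 1
    simp [φ] at h0 h1
    have h2 : p * d + 2 * q * b = p' * d + 2 * q' * b := by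
      rw [h0] at h1; linarith
    have e1 : p = p' := by linear_combination (p' - p) * h + a * h2 - b * h0
    have e2 : 2 * q = 2 * q' := by linear_combination (2 * q' - 2 * q) * h + d * h0 - c * h2
    ext
    · exact e1
    · exact mul_left_cancel₀ two_ne_zero e2
  have hterm : ∀ p : ℤ × ℤ, ‖(((p.1 * L.ω₁ + p.2 * L.ω₂ : ℂ)) ^ k)⁻¹‖ ≤
      r ⟨⟨1, 2⟩, Nat.ofNat_pos⟩ ^ (-(k : ℝ)) * ‖φ p‖ ^ (-(k : ℝ)) := by
    intro p
    have := summand_bound_of_mem_verticalStrip (z := τ') (k := k) (Nat.cast_nonneg k) (φ p) two_pos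
      (by simpa using hn')
    refine le_trans (le_of_eq ?_) this
    rw [Real.rpow_neg (norm_nonneg _), Real.rpow_natCast, norm_inv, norm_pow]
    congr 3
    simp [φ, hL, pp, hc]
    ring
  have hS' : Summable fun p => r ⟨⟨1, 2⟩, Nat.ofNat_pos⟩ ^ (-(k : ℝ)) * ‖φ p‖ ^ (-(k : ℝ)) :=
    hS.comp_injective hφ
  have hG : L.G k = ∑' p : ℤ × ℤ, ((p.1 * L.ω₁ + p.2 * L.ω₂ : ℂ) ^ k)⁻¹ := by
    rw [PeriodPair.G, ← L.latticeEquivProd.symm.toEquiv.tsum_eq]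
    refine tsum_congr fun p => ?_
    simp [L.latticeEquiv_symm_apply]
  rw [hG]
  refine (tsum_of_norm_bounded hS'.hasSum hterm).trans ?_
  exact tsum_comp_le_tsum_of_inj hS (fun x => by
    have := (r_pos ⟨⟨1, 2⟩, Nat.ofNat_pos⟩).le
    positivity) hφ

lemma cubic_bound {x g h : ℂ} {A B : ℝ} (hA : ‖g‖ ≤ A) (hB : ‖h‖ ≤ B)
    (hx : 4 * x ^ 3 = g * x + h) : ‖x‖ ≤ 1 + A + B := by
  by_contra! hc
  have hA0 := (norm_nonneg g).trans hA
  have hB0 := (norm_nonneg h).trans hB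
  have h1 : 4 * ‖x‖ ^ 3 ≤ A * ‖x‖ + B := by
    calc 4 * ‖x‖ ^ 3 = ‖4 * x ^ 3‖ := by simp
      _ = ‖g * x + h‖ := by rw [hx]
      _ ≤ ‖g‖ * ‖x‖ + ‖h‖ := (norm_add_le _ _).trans (by rw [norm_mul])
      _ ≤ _ := by gcongr
  have hx1 : 1 ≤ ‖x‖ := by linarith
  have h2 : A * ‖x‖ + B ≤ (A + B) * ‖x‖ ^ 2 := by
    nlinarith [mul_nonneg hA0 (norm_nonneg x), mul_nonneg hB0 (norm_nonneg x)]
  nlinarith [pow_pos (by linarith : 0 < ‖x‖) 2]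

lemma half_bound : ∃ B : ℝ, ∀ (a b c d : ℤ) (h : a * d - b * c = 1)
    (τ : UpperHalfPlane), 2 ≤ τ.im →
    ‖(pp a b c d h τ τ.2).weierstrassP ((c * τ + d) / 2 + (a * τ + b))‖ ≤ B := by
  obtain ⟨B4, h4⟩ := G_bound 4 (by norm_num)
  obtain ⟨B6, h6⟩ := G_bound 6 (by norm_num)
  refine ⟨1 + 60 * B4 + 140 * B6, ?_⟩
  intro a b c d h τ hτ
  have h4 := h4 a b c d h τ hτ
  have h6 := h6 a b c d h τ hτ
  set L := pp a b c d h τ τ.2 with hL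
  set w : ℂ := (c * τ + d) / 2 + (a * τ + b) with hw
  have hw' : w = ((1 / 2 : ℚ) : ℂ) * L.ω₁ + ((1 / 2 : ℚ) : ℂ) * L.ω₂ := by
    simp only [hL, pp, hw]; push_cast; ring
  have hmem : w ∉ L.lattice := by
    rw [hw', PeriodPair.mul_ω₁_add_mul_ω₂_mem_lattice]
    norm_num
  have h2w : ((1 : ℤ) : ℂ) * L.ω₁ + ((1 : ℤ) : ℂ) * L.ω₂ ∈ L.lattice :=
    PeriodPair.mem_lattice.mpr ⟨_, _, rfl⟩
  have hd : L.derivWeierstrassP w = 0 := by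
    have e := L.derivWeierstrassP_add_coe (-w) ⟨_, h2w⟩
    rw [L.derivWeierstrassP_neg] at e
    have : -w + (((1 : ℤ) : ℂ) * L.ω₁ + ((1 : ℤ) : ℂ) * L.ω₂) = w := by
      rw [hw']; push_cast; ring
    simp only [this] at e
    exact CharZero.eq_neg_self_iff.mp e
  have hrel := L.derivWeierstrassP_sq w hmem
  rw [hd] at hrel
  refine cubic_bound (g := L.g₂) (h := L.g₃) ?_ ?_ (by linear_combination -hrel)
  · rw [PeriodPair.g₂, norm_mul]; simpa using h4
  · rw [PeriodPair.g₃, norm_mul]; simpa using h6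

open EisensteinSeries in
lemma term_bound (τ : UpperHalfPlane) (p : ℤ × ℤ) (hp : p ≠ 0) :
    ‖1 / ((1 / 2 + (τ : ℂ)) - ((p.1 : ℂ) + (p.2 : ℂ) * (2 * τ))) ^ 2 -
      1 / ((p.1 : ℂ) + (p.2 : ℂ) * (2 * τ)) ^ 2‖ ≤
    ‖1 / 2 + (τ : ℂ)‖ * 6 * (r τ ^ 3)⁻¹ * ‖![p.1, p.2]‖ ^ (-3 : ℝ) := by
  set l : ℂ := (p.1 : ℂ) + (p.2 : ℂ) * (2 * τ) with hl
  set w : ℂ := 1 / 2 + (τ : ℂ) with hw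
  have hr := r_pos τ
  have hp' : p.1 ≠ 0 ∨ p.2 ≠ 0 := by
    by_contra! hh
    exact hp (Prod.ext hh.1 hh.2)
  have hN : 0 < ‖![p.1, p.2]‖ := by
    rw [norm_pos_iff]
    intro h0
    have h1 := congrFun h0 0
    have h2 := congrFun h0 1
    simp at h1 h2
    tauto
  have hx : ‖![p.1, p.2]‖ ≤ ‖![2 * p.2, p.1]‖ := by
    rw [norm_eq_max_natAbs, norm_eq_max_natAbs]
    simp only [Matrix.cons_val_zero, Matrix.cons_val_one]
    norm_cast
    omega
  have hx' : ‖![p.1, p.2]‖ ≤ ‖![2 - 4 * p.2, 1 - 2 * p.1]‖ := by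
    rw [norm_eq_max_natAbs, norm_eq_max_natAbs]
    simp only [Matrix.cons_val_zero, Matrix.cons_val_one]
    norm_cast
    omega
  set N := ‖![p.1, p.2]‖ with hNdef
  have b1 : r τ * N ≤ ‖l‖ := by
    have h0 : ![2 * p.2, p.1] ≠ 0 := by
      rw [← norm_pos_iff]; linarith
    have := r_mul_max_le τ h0
    refine (mul_le_mul_of_nonneg_left hx hr.le).trans (this.trans (le_of_eq ?_))
    congr 1
    simp [hl]
    ring
  have b2 : r τ * N ≤ 2 * ‖w - l‖ := by
    have h0 : ![2 - 4 * p.2, 1 - 2 * p.1] ≠ 0 := by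
      rw [← norm_pos_iff]; linarith
    have := r_mul_max_le τ h0
    refine (mul_le_mul_of_nonneg_left hx' hr.le).trans (this.trans (le_of_eq ?_))
    rw [show 2 * ‖w - l‖ = ‖2 * (w - l)‖ by simp]
    congr 1
    simp [hl, hw]
    ring
  have hR : 0 < r τ * N := mul_pos hr hN
  set R := r τ * N with hRdef
  have p1 : 0 < ‖l‖ := by linarith
  have p2 : 0 < ‖w - l‖ := by linarith
  have n1 : l ≠ 0 := norm_pos_iff.mp p1
  have n2 : w - l ≠ 0 := norm_pos_iff.mp p2
  have key : 1 / (w - l) ^ 2 - 1 / l ^ 2 =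
      w * (1 / ((w - l) ^ 2 * l) - 1 / ((w - l) * l ^ 2)) := by
    field_simp
    ring
  have q1 : ‖1 / ((w - l) ^ 2 * l)‖ ≤ 4 * (R ^ 3)⁻¹ := by
    rw [norm_div, norm_one, norm_mul, norm_pow]
    have : R ^ 3 / 4 ≤ ‖w - l‖ ^ 2 * ‖l‖ := by
      calc R ^ 3 / 4 = (R / 2) ^ 2 * R := by ring
        _ ≤ _ := by gcongr; linarith
    calc 1 / (‖w - l‖ ^ 2 * ‖l‖) ≤ 1 / (R ^ 3 / 4) := by gcongr
      _ = _ := by field_simp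
  have q2 : ‖1 / ((w - l) * l ^ 2)‖ ≤ 2 * (R ^ 3)⁻¹ := by
    rw [norm_div, norm_one, norm_mul, norm_pow]
    have : R ^ 3 / 2 ≤ ‖w - l‖ * ‖l‖ ^ 2 := by
      calc R ^ 3 / 2 = (R / 2) * R ^ 2 := by ring
        _ ≤ _ := by gcongr; linarith
    calc 1 / (‖w - l‖ * ‖l‖ ^ 2) ≤ 1 / (R ^ 3 / 2) := by gcongr
      _ = _ := by field_simp
  have hNr : N ^ (-3 : ℝ) = (N ^ 3)⁻¹ := by
    rw [Real.rpow_neg hN.le]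
    norm_cast
  rw [key, norm_mul, hNr]
  calc ‖w‖ * ‖1 / ((w - l) ^ 2 * l) - 1 / ((w - l) * l ^ 2)‖
      ≤ ‖w‖ * (4 * (R ^ 3)⁻¹ + 2 * (R ^ 3)⁻¹) := by
        gcongr
        exact (norm_sub_le _ _).trans (add_le_add q1 q2)
    _ = _ := by
        rw [hRdef, mul_pow, mul_inv]
        ring

/-- Half-lattice-shifted points avoid zero. -/
lemma lin_ne_zero {t : ℂ} (ht : 0 < t.im) (u v : ℤ) (h : u ≠ 0 ∨ v ≠ 0) :
    (u : ℂ) * t + v ≠ 0 := by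
  intro h0
  have him := congrArg Complex.im h0
  have hre := congrArg Complex.re h0
  simp at him hre
  have hu : u = 0 := by
    rcases him with h | h
    · exact h
    · exact absurd h ht.ne'
  subst hu
  simp at hre
  tauto

open EisensteinSeries in
lemma differentiableOn_phi :
    DifferentiableOn ℂ (fun t : ℂ => wpa (1 / 2 + t) (2 * t)) UpperHalfPlane.upperHalfPlaneSet := by
  intro τ hτ
  have hτ' : 0 < τ.im := hτ
  let A : ℝ := |τ.re| + 1
  let B : ℝ := τ.im / 2
  have hB : 0 < B := by simp only [B]; linarith
  let U : Set ℂ := {t | |t.re| < A} ∩ {t | B < t.im} ∩ {t | ‖1 / 2 + t‖ < ‖1 / 2 + τ‖ + 1}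
  have hU : IsOpen U := by
    refine IsOpen.inter (IsOpen.inter ?_ ?_) ?_
    · exact isOpen_lt (by fun_prop) continuous_const
    · exact isOpen_lt continuous_const (by fun_prop)
    · exact isOpen_lt (by fun_prop) continuous_const
  have hmem : τ ∈ U := by
    refine ⟨⟨?_, ?_⟩, ?_⟩ <;> simp [A, B, hτ']
  have hpos : ∀ t ∈ U, 0 < t.im := fun t ht => hB.trans ht.1.2
  have hlin1 : ∀ t ∈ U, ∀ p : ℤ × ℤ, p ≠ 0 → ((p.1 : ℂ) + (p.2 : ℂ) * (2 * t)) ≠ 0 := by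
    intro t ht p hp
    have := lin_ne_zero (hpos t ht) (2 * p.2) p.1 (by
      by_contra! hh
      exact hp (Prod.ext hh.2 (by simpa using hh.1)))
    convert this using 1
    push_cast; ring
  have hlin2 : ∀ t ∈ U, ∀ p : ℤ × ℤ, ((1 / 2 + t) - ((p.1 : ℂ) + (p.2 : ℂ) * (2 * t))) ≠ 0 := by
    intro t ht p h0
    refine lin_ne_zero (hpos t ht) (2 - 4 * p.2) (1 - 2 * p.1) (Or.inr (by omega)) ?_
    push_cast
    linear_combination 2 * h0
  have hd : DifferentiableOn ℂ (fun t : ℂ => wpa (1 / 2 + t) (2 * t)) U := by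
    unfold wpa
    refine DifferentiableOn.const_mul (DifferentiableOn.add ?_ ?_) _
    · refine DifferentiableOn.div (by fun_prop) (by fun_prop) fun t ht => pow_ne_zero _ ?_
      simpa using hlin2 t ht 0
    · have hs : Summable fun p : ℤ × ℤ => (‖1 / 2 + τ‖ + 1) * 6 * (r ⟨⟨A, B⟩, hB⟩ ^ 3)⁻¹ *
          ‖![p.1, p.2]‖ ^ (-3 : ℝ) := by
        refine Summable.mul_left _ ?_
        exact ((finTwoArrowEquiv ℤ).symm.summable_iff).mpr
          (summable_one_div_norm_rpow (k := 3) (by norm_num))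
      refine differentiableOn_tsum_of_summable_norm hs ?_ hU ?_
      · intro p
        split_ifs with hp
        · fun_prop
        · refine DifferentiableOn.sub ?_ ?_
          · exact DifferentiableOn.div (by fun_prop) (by fun_prop)
              fun t ht => pow_ne_zero _ (hlin2 t ht p)
          · exact DifferentiableOn.div (by fun_prop) (by fun_prop)
              fun t ht => pow_ne_zero _ (hlin1 t ht p hp)
      · intro p t ht
        have hr0 := r_pos ⟨⟨A, B⟩, hB⟩
        split_ifs with hp
        · simp only [norm_zero]
          positivity
        · refine (term_bound ⟨t, hpos t ht⟩ p hp).trans ?_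
          have hrr := r_lower_bound_on_verticalStrip (⟨t, hpos t ht⟩ : UpperHalfPlane) hB
            (A := A) ⟨ht.1.1.le, ht.1.2.le⟩
          have hrt := r_pos ⟨t, hpos t ht⟩
          have hw : ‖1 / 2 + t‖ ≤ ‖1 / 2 + τ‖ + 1 := ht.2.le
          change ‖1 / 2 + t‖ * 6 * _ * _ ≤ _
          gcongr
  exact ((hd.differentiableAt (hU.mem_nhds hmem))).differentiableWithinAt

/-- The function `Φ` on the upper half plane. -/
noncomputable def phi (τ : UpperHalfPlane) : ℂ := wpa (1 / 2 + (τ : ℂ)) (2 * (τ : ℂ))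

lemma det_eq (γ : Matrix.SpecialLinearGroup (Fin 2) ℤ) : γ 0 0 * γ 1 1 - γ 0 1 * γ 1 0 = 1 := by
  rw [← Matrix.det_fin_two]
  exact γ.2

lemma coe_smul' (γ : Matrix.SpecialLinearGroup (Fin 2) ℤ) (τ : UpperHalfPlane) :
    ((γ • τ : UpperHalfPlane) : ℂ) =
      ((γ 0 0 : ℂ) * τ + (γ 0 1 : ℂ)) / ((γ 1 0 : ℂ) * τ + (γ 1 1 : ℂ)) := by
  rw [UpperHalfPlane.coe_specialLinearGroup_apply]
  simp

open scoped ModularForm in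
lemma phi_slash (γ : Matrix.SpecialLinearGroup (Fin 2) ℤ) (hγ : γ ∈ CongruenceSubgroup.Gamma0 4) :
    phi ∣[(2 : ℤ)] γ = phi := by
  ext τ
  rw [ModularForm.slash_action_eq'_iff]
  rw [phi, phi, coe_smul']
  have hc : (4 : ℤ) ∣ γ 1 0 := by
    rw [CongruenceSubgroup.Gamma0_mem] at hγ
    exact (ZMod.intCast_zmod_eq_zero_iff_dvd _ 4).mp hγ
  exact_mod_cast wpa_gamma0 (det_eq γ) hc τ.2

open scoped ModularForm in
lemma phi_bdd (γ : Matrix.SpecialLinearGroup (Fin 2) ℤ) :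
    UpperHalfPlane.IsBoundedAtImInfty (phi ∣[(2 : ℤ)] γ) := by
  obtain ⟨B, hB⟩ := half_bound
  rw [UpperHalfPlane.isBoundedAtImInfty_iff]
  refine ⟨‖(Real.pi : ℂ)⁻¹ ^ 2‖ * B, 2, fun τ hτ => ?_⟩
  have hne := denom_ne (det_eq γ) τ.2
  have : (phi ∣[(2 : ℤ)] γ) τ = (Real.pi : ℂ)⁻¹ ^ 2 *
      (pp (γ 0 0) (γ 0 1) (γ 1 0) (γ 1 1) (det_eq γ) τ τ.2).weierstrassP
        ((γ 1 0 * τ + γ 1 1) / 2 + (γ 0 0 * τ + γ 0 1)) := by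
    rw [ModularForm.SL_slash_apply, phi, coe_smul', wpa_moeb (det_eq γ) τ.2,
      ModularGroup.denom_apply, zpow_neg]
    rw [mul_comm, ← mul_assoc]
    norm_cast
    rw [inv_mul_cancel₀, one_mul]
    exact pow_ne_zero 2 (by exact_mod_cast hne)
  rw [this, norm_mul]
  gcongr
  exact hB _ _ _ _ _ τ hτ

/-- `Φ` as a modular form. -/
noncomputable def phiForm : ModularForm (CongruenceSubgroup.Gamma0 4) 2 where
  toFun := phi
  slash_action_eq' := by
    rintro _ ⟨γ, hγ, rfl⟩
    exact phi_slash γ hγ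
  holo' := by
    change MDifferentiable _ _ phi
    rw [UpperHalfPlane.mdifferentiable_iff]
    refine differentiableOn_phi.congr fun z hz => ?_
    simp [phi, UpperHalfPlane.ofComplex_apply_of_im_pos hz]
  bdd_at_cusps' := by
    intro c hc
    rw [Subgroup.IsArithmetic.isCusp_iff_isCusp_SL2Z] at hc
    rw [OnePoint.isBoundedAt_iff_forall_SL2Z hc]
    exact fun γ _ => phi_bdd γ

end PhiAux

open UpperHalfPlane in
/-- For `Φ(τ) = ℘a(1/2 + τ, 2τ)`: `Φ(τ/(4τ+1)) = (4τ+1)² Φ(τ)`; consequently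
`Φ` is a modular form of weight 2 for `Γ₀(4)`. -/
theorem wpa_phi_gamma0_four :
    (∀ τ : ℂ, 0 < τ.im →
        wpa (1 / 2 + τ / (4 * τ + 1)) (2 * (τ / (4 * τ + 1))) =
          (4 * τ + 1) ^ 2 * wpa (1 / 2 + τ) (2 * τ)) ∧
      ∃ f : ModularForm (CongruenceSubgroup.Gamma0 4) 2,
        ∀ τ : UpperHalfPlane, f τ = wpa (1 / 2 + (τ : ℂ)) (2 * (τ : ℂ)) := by
  refine ⟨fun τ hτ => ?_, PhiAux.phiForm, fun τ => rfl⟩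
  simpa using PhiAux.wpa_gamma0 (a := 1) (b := 0) (c := 4) (d := 1) (by norm_num) (by norm_num) hτ
end
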